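/- arXiv:2408.02428 — 2 statements merged into one kernel-verified Lean document; each statement's English description precedes it below -/
import Mathlib

section
/- Let m,n be positive integers with either m = n ≥ 3, or m ≠ n and m,n ≥ 2, and let 𝓛 : ℝ^{m×n} → ℝ^{m×n} be a linear transformation. Then the following are equivalent: (1) 𝓛 maps the set of SR matrices onto itself; (2) 𝓛 maps the set of SR₂ matrices onto itself; (3) 𝓛 is a composition of one or more of the following transformations: (a) A ↦ F·A·E, where F ∈ ℝ^{m×m} and E ∈ ℝ^{n×n} are diagonal matrices with positive diagonal entries; (b) A ↦ −A; (c) A ↦ P_m·A, where P_m is the m×m exchange matrix; (d) A ↦ A·P_n, where P_n is the n×n exchange matrix; (e) A ↦ Aᵀ, the last being allowed only when m = n. -/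
open Matrix

/-- The `n × n` exchange matrix: ones on the antidiagonal, zeros elsewhere. -/
def exchangeMat (n : ℕ) : Matrix (Fin n) (Fin n) ℝ :=
  Matrix.of fun i j => if j = i.rev then (1 : ℝ) else 0

/-- `A` is sign regular of order `k` (SRₖ): for each `1 ≤ r ≤ k` there is a sign
`ε ∈ {1, -1}` such that every nonzero `r × r` minor of `A` has sign `ε`. -/
def IsSRk {m n : ℕ} (k : ℕ) (A : Matrix (Fin m) (Fin n) ℝ) : Prop :=
  ∀ r : ℕ, 1 ≤ r → r ≤ k →
    ∃ ε : ℝ, (ε = 1 ∨ ε = -1) ∧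
      ∀ (f : Fin r → Fin m) (g : Fin r → Fin n),
        StrictMono f → StrictMono g →
        (A.submatrix f g).det ≠ 0 → 0 < ε * (A.submatrix f g).det

/-- `A` is sign regular (SR): sign regular of order `min m n`. -/
def IsSR {m n : ℕ} (A : Matrix (Fin m) (Fin n) ℝ) : Prop :=
  IsSRk (min m n) A

/-- The elementary transformations (a)–(e) of Theorem A:
positive diagonal equivalence, negation, left/right multiplication by an
exchange matrix, and (when `m = n`) transposition. -/
def ElemSRMap (m n : ℕ)
    (T : Matrix (Fin m) (Fin n) ℝ → Matrix (Fin m) (Fin n) ℝ) : Prop :=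
  (∃ F : Fin m → ℝ, ∃ Ed : Fin n → ℝ, (∀ i, 0 < F i) ∧ (∀ j, 0 < Ed j) ∧
      T = fun A => Matrix.diagonal F * A * Matrix.diagonal Ed) ∨
  (T = fun A => -A) ∨
  (T = fun A => exchangeMat m * A) ∨
  (T = fun A => A * exchangeMat n) ∨
  (∃ h : m = n,
      T = fun A => Matrix.of fun i j => A (Fin.cast h.symm j) (Fin.cast h i))

/-- The additive analogue of the `2 × 2` minor in rows `i, k` and columns `j, l`. -/
def additiveMinor {I J : Type*} (x : I × J → ℝ) (i k : I) (j l : J) : ℝ :=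
  x (i, j) + x (k, l) - x (i, l) - x (k, j)

theorem nonneg_or_nonpos_of_mul_nonneg {ι : Type*} {v : ι → ℝ}
    (h : ∀ s t, 0 ≤ v s * v t) : (∀ s, 0 ≤ v s) ∨ (∀ s, v s ≤ 0) := by
  by_contra! hc
  obtain ⟨⟨s, hs⟩, t, ht⟩ := hc
  nlinarith [h s t, mul_pos_of_neg_of_neg hs (neg_neg_of_pos ht)]

theorem mul_eq_mul_of_forall_affine_mul_nonneg {p v q w : ℝ}
    (h : ∀ t : ℝ, 0 ≤ (p + t * v) * (q + t * w)) : p * w = q * v := by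
  have hd : discrim (v * w) (p * w + q * v) (p * q) ≤ 0 :=
    discrim_le_zero fun t => by have := h t; linarith
  have hs : (p * w - q * v) ^ 2 ≤ 0 := by
    unfold discrim at hd
    linarith
  exact sub_eq_zero.mp (pow_eq_zero_iff two_ne_zero |>.mp (le_antisymm hs (sq_nonneg _)))

theorem det_eq_zero_of_eq_add_vecMulVec {r : ℕ} (hr : 3 ≤ r) {A : Matrix (Fin r) (Fin r) ℝ}
    (a c b d : Fin r → ℝ) (hA : ∀ i j, A i j = a i * b j + c i * d j) : A.det = 0 := by
  have hmul : A = (Matrix.of fun i (s : Fin 2) => ![a i, c i] s) *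
      (Matrix.of fun (s : Fin 2) j => ![b j, d j] s) := by
    ext i j
    simp [Matrix.mul_apply, hA]
  by_contra hdet
  have hrank : A.rank = r := by
    simpa using Matrix.rank_of_isUnit A
      ((Matrix.isUnit_iff_isUnit_det A).2 (isUnit_iff_ne_zero.2 hdet))
  have hle : A.rank ≤ 2 := by
    rw [hmul]
    exact (Matrix.rank_mul_le_left _ _).trans (by
      simpa using Matrix.rank_le_card_width (Matrix.of fun i (s : Fin 2) => ![a i, c i] s))
  omega

theorem isSRk_of_rank_two {m n : ℕ} (k : ℕ) {A : Matrix (Fin m) (Fin n) ℝ}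
    (a c : Fin m → ℝ) (b d : Fin n → ℝ) (hA : ∀ i j, A i j = a i * b j + c i * d j)
    (h0 : ∀ i j, 0 ≤ A i j)
    (hac : (∀ i k, i < k → 0 ≤ a i * c k - a k * c i) ∨
      (∀ i k, i < k → a i * c k - a k * c i ≤ 0))
    (hbd : (∀ j l, j < l → 0 ≤ b j * d l - b l * d j) ∨
      (∀ j l, j < l → b j * d l - b l * d j ≤ 0)) : IsSRk k A := by
  intro r hr _
  obtain rfl | rfl | hr3 : r = 1 ∨ r = 2 ∨ 3 ≤ r := by omega
  · refine ⟨1, Or.inl rfl, fun f g _ _ hdet => ?_⟩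
    rw [Matrix.det_fin_one] at hdet ⊢
    rw [one_mul]
    exact lt_of_le_of_ne (h0 _ _) hdet.symm
  · have key : ∀ (f : Fin 2 → Fin m) (g : Fin 2 → Fin n), (A.submatrix f g).det =
        (a (f 0) * c (f 1) - a (f 1) * c (f 0)) * (b (g 0) * d (g 1) - b (g 1) * d (g 0)) := by
      intro f g
      rw [Matrix.det_fin_two]
      simp only [Matrix.submatrix_apply, hA]
      ring
    have pos : (∀ (f : Fin 2 → Fin m) (g : Fin 2 → Fin n), StrictMono f → StrictMono g →
        0 ≤ (A.submatrix f g).det) ∨ (∀ (f : Fin 2 → Fin m) (g : Fin 2 → Fin n),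
        StrictMono f → StrictMono g → (A.submatrix f g).det ≤ 0) := by
      rcases hac with hac | hac <;> rcases hbd with hbd | hbd
      · exact Or.inl fun f g hf hg => key f g ▸
          mul_nonneg (hac _ _ (hf zero_lt_one)) (hbd _ _ (hg zero_lt_one))
      · exact Or.inr fun f g hf hg => key f g ▸
          mul_nonpos_of_nonneg_of_nonpos (hac _ _ (hf zero_lt_one)) (hbd _ _ (hg zero_lt_one))
      · exact Or.inr fun f g hf hg => key f g ▸
          mul_nonpos_of_nonpos_of_nonneg (hac _ _ (hf zero_lt_one)) (hbd _ _ (hg zero_lt_one))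
      · exact Or.inl fun f g hf hg => key f g ▸
          mul_nonneg_of_nonpos_of_nonpos (hac _ _ (hf zero_lt_one)) (hbd _ _ (hg zero_lt_one))
    rcases pos with pos | pos
    · exact ⟨1, Or.inl rfl, fun f g hf hg hdet => by
        simpa using lt_of_le_of_ne (pos f g hf hg) hdet.symm⟩
    · exact ⟨-1, Or.inr rfl, fun f g hf hg hdet => by
        simpa using lt_of_le_of_ne (pos f g hf hg) hdet⟩
  · refine ⟨1, Or.inl rfl, fun f g _ _ hdet => absurd ?_ hdet⟩
    exact det_eq_zero_of_eq_add_vecMulVec hr3 (a ∘ f) (c ∘ f) (b ∘ g) (d ∘ g)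
      fun i j => hA (f i) (g j)

theorem mul_nonneg_of_common_sign {ε x y : ℝ} (hx : x ≠ 0 → 0 < ε * x)
    (hy : y ≠ 0 → 0 < ε * y) : 0 ≤ x * y := by
  by_cases hx0 : x = 0
  · simp [hx0]
  by_cases hy0 : y = 0
  · simp [hy0]
  have := mul_pos (hx hx0) (hy hy0)
  have h : 0 < ε ^ 2 * (x * y) := by linarith
  exact (pos_of_mul_pos_right h (sq_nonneg ε)).le

theorem IsSRk.entry_mul_entry_nonneg {m n k : ℕ} {A : Matrix (Fin m) (Fin n) ℝ}
    (hA : IsSRk k A) (hk : 1 ≤ k) (i i' : Fin m) (j j' : Fin n) : 0 ≤ A i j * A i' j' := by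
  obtain ⟨ε, -, h⟩ := hA 1 le_rfl hk
  have key : ∀ i j, A i j ≠ 0 → 0 < ε * A i j := by
    intro i j hij
    have := h (fun _ => i) (fun _ => j) (Subsingleton.strictMono _) (Subsingleton.strictMono _)
    rw [Matrix.det_fin_one] at this
    exact this hij
  exact mul_nonneg_of_common_sign (key i j) (key i' j')

theorem IsSRk.minor_mul_minor_nonneg {m n k : ℕ} {A : Matrix (Fin m) (Fin n) ℝ}
    (hA : IsSRk k A) (hk : 2 ≤ k) {i₁ i₂ i₃ i₄ : Fin m} {j₁ j₂ j₃ j₄ : Fin n}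
    (hi : i₁ < i₂) (hj : j₁ < j₂) (hi' : i₃ < i₄) (hj' : j₃ < j₄) :
    0 ≤ (A i₁ j₁ * A i₂ j₂ - A i₁ j₂ * A i₂ j₁) * (A i₃ j₃ * A i₄ j₄ - A i₃ j₄ * A i₄ j₃) := by
  obtain ⟨ε, -, h⟩ := hA 2 (by norm_num) hk
  have key : ∀ i k j l, i < k → j < l → A i j * A k l - A i l * A k j ≠ 0 →
      0 < ε * (A i j * A k l - A i l * A k j) := by
    intro i k j l hik hjl hne
    have := h ![i, k] ![j, l] (by simpa [Fin.strictMono_iff_lt_succ] using hik)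
      (by simpa [Fin.strictMono_iff_lt_succ] using hjl)
    rw [Matrix.det_fin_two] at this
    simpa using this (by simpa using hne)
  exact mul_nonneg_of_common_sign (key _ _ _ _ hi hj) (key _ _ _ _ hi' hj')

/-- If nonnegative combinations of `x ≥ 0` and `y ≤ 0` never take both signs, then `x` and `y`
are proportional. -/
theorem mul_eq_mul_of_combination_mul_nonneg {ι : Type*} {x y : ι → ℝ} (hx : ∀ s, 0 ≤ x s)
    (hy : ∀ s, y s ≤ 0) (h : ∀ a : ℝ, 0 ≤ a → ∀ s t, 0 ≤ (x s + a * y s) * (x t + a * y t))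
    (s t : ι) : x s * y t = x t * y s := by
  have key : ∀ s t, x t * y s ≤ x s * y t := by
    intro s t
    by_contra! hlt
    have h1 : 0 ≤ x t * -y s := mul_nonneg (hx t) (by linarith [hy s])
    have hyt : y t < 0 := lt_of_le_of_ne (hy t) fun h0 => by
      rw [h0, mul_zero] at hlt; nlinarith
    set δ := (x t * y s - x s * y t) / (1 - y s) with hδ
    have hden : 0 < 1 - y s := by linarith [hy s]
    have hδ0 : 0 < δ := div_pos (by linarith) hden
    have hδe : δ * (1 - y s) = x t * y s - x s * y t := div_mul_cancel₀ _ hden.ne'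
    set a := (x t + δ) / (-y t) with ha
    have hae : a * (-y t) = x t + δ := div_mul_cancel₀ _ (by linarith)
    have hh := h a (div_nonneg (by linarith [hx t]) (by linarith)) s t
    have e1 : x t + a * y t = -δ := by linarith
    have e2 : (x s + a * y s) * (-y t) = δ := by linear_combination y s * hae - hδe
    rw [e1] at hh
    have : 0 < x s + a * y s := pos_of_mul_pos_left (e2.symm ▸ hδ0) (by linarith)
    nlinarith
  exact le_antisymm (key t s) (key s t)

section Monomial

variable {ι : Type*} [Fintype ι] [DecidableEq ι]

theorem linearMap_pi_apply_eq_sum (T : (ι → ℝ) →ₗ[ℝ] (ι → ℝ)) (x : ι → ℝ) (s : ι) :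
    T x s = ∑ p, x p * T (Pi.single p 1) s := by
  conv_lhs => rw [pi_eq_sum_univ' x]
  simp only [map_sum, map_smul, Finset.sum_apply, Pi.smul_apply, smul_eq_mul]

/-- A nonnegative linear automorphism with nonnegative inverse is monomial. -/
theorem exists_monomial_of_nonneg (T : (ι → ℝ) ≃ₗ[ℝ] (ι → ℝ))
    (h : ∀ p s, 0 ≤ T (Pi.single p 1) s) (h' : ∀ p s, 0 ≤ T.symm (Pi.single p 1) s) :
    ∃ (τ : ι ≃ ι) (c : ι → ℝ), (∀ s, 0 < c s) ∧ ∀ x s, T x s = c s * x (τ s) := by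
  have sum := linearMap_pi_apply_eq_sum T.toLinearMap
  simp only [LinearEquiv.coe_coe] at sum
  have exists_preimage : ∀ s, ∃ p, ∀ t, t ≠ s → T (Pi.single p 1) t = 0 := by
    intro s
    have hne : T.symm (Pi.single s 1) ≠ 0 := by simp
    obtain ⟨p, hp⟩ := Function.ne_iff.mp hne
    refine ⟨p, fun t ht => ?_⟩
    have h0 := sum (T.symm (Pi.single s 1)) t
    rw [T.apply_symm_apply, Pi.single_eq_of_ne ht, eq_comm,
      Finset.sum_eq_zero_iff_of_nonneg fun q _ => mul_nonneg (h' s q) (h q t)] at h0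
    exact (mul_eq_zero.mp (h0 p (Finset.mem_univ p))).resolve_left hp
  choose τ hτ using exists_preimage
  have hpos : ∀ s, 0 < T (Pi.single (τ s) 1) s := by
    intro s
    refine lt_of_le_of_ne (h _ _) fun h0 => ?_
    have : T (Pi.single (τ s) 1) = 0 := by
      ext t
      by_cases ht : t = s
      · rw [ht, ← h0]; rfl
      · rw [hτ s t ht]; rfl
    simp at this
  have hinj : Function.Injective τ := by
    intro s t hst
    by_contra hne
    have := hpos s
    rw [hst, hτ t s hne] at this
    exact lt_irrefl _ this
  refine ⟨Equiv.ofBijective τ (Finite.injective_iff_bijective.mp hinj),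
    fun s => T (Pi.single (τ s) 1) s, hpos, fun x s => ?_⟩
  rw [sum, Finset.sum_eq_single (τ s)]
  · simp [mul_comm]
  · intro p _ hp
    obtain ⟨t, rfl⟩ := (Finite.injective_iff_surjective.mp hinj) p
    rw [hτ t s (fun hst => hp (by rw [hst])), mul_zero]
  · simp

theorem exists_monomial_of_nonneg_of_symm_mul_nonneg (T : (ι → ℝ) ≃ₗ[ℝ] (ι → ℝ))
    (h : ∀ p s, 0 ≤ T (Pi.single p 1) s)
    (h' : ∀ p s t, 0 ≤ T.symm (Pi.single p 1) s * T.symm (Pi.single p 1) t) :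
    ∃ (τ : ι ≃ ι) (c : ι → ℝ), (∀ s, 0 < c s) ∧ ∀ x s, T x s = c s * x (τ s) := by
  refine exists_monomial_of_nonneg T h fun p => ?_
  refine (nonneg_or_nonpos_of_mul_nonneg (h' p)).resolve_right fun hneg => ?_
  have sum := linearMap_pi_apply_eq_sum T.toLinearMap (T.symm (Pi.single p 1)) p
  simp only [LinearEquiv.coe_coe, T.apply_symm_apply, Pi.single_eq_same] at sum
  have : ∑ q, T.symm (Pi.single p 1) q * T (Pi.single q 1) p ≤ 0 :=
    Finset.sum_nonpos fun q _ => mul_nonpos_of_nonpos_of_nonneg (hneg q) (h q p)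
  linarith

/-- A linear automorphism which never creates mixed signs from nonnegative combinations of two
basis vectors, and whose inverse does not create mixed signs from basis vectors, is monomial
up to a global sign. -/
theorem exists_monomial_of_mul_nonneg (T : (ι → ℝ) ≃ₗ[ℝ] (ι → ℝ))
    (h : ∀ p q (a : ℝ), 0 ≤ a → ∀ s t, 0 ≤ T (Pi.single p 1 + a • Pi.single q 1) s *
      T (Pi.single p 1 + a • Pi.single q 1) t)
    (h' : ∀ p s t, 0 ≤ T.symm (Pi.single p 1) s * T.symm (Pi.single p 1) t) :
    ∃ ε : ℝ, (ε = 1 ∨ ε = -1) ∧ ∃ (τ : ι ≃ ι) (c : ι → ℝ), (∀ s, 0 < c s) ∧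
      ∀ x s, T x s = ε * (c s * x (τ s)) := by
  simp only [map_add, map_smul, Pi.add_apply, Pi.smul_apply, smul_eq_mul] at h
  have sign : ∀ p, (∀ s, 0 ≤ T (Pi.single p 1) s) ∨ (∀ s, T (Pi.single p 1) s ≤ 0) := fun p =>
    nonneg_or_nonpos_of_mul_nonneg fun s t => by simpa using h p p 0 le_rfl s t
  by_cases hall : ∀ p s, 0 ≤ T (Pi.single p 1) s
  · obtain ⟨τ, c, hc, hT⟩ := exists_monomial_of_nonneg_of_symm_mul_nonneg T hall h'
    exact ⟨1, Or.inl rfl, τ, c, hc, fun x s => by rw [hT, one_mul]⟩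
  push Not at hall
  obtain ⟨p₀, s₀, hs₀⟩ := hall
  have hp₀ : ∀ s, T (Pi.single p₀ 1) s ≤ 0 :=
    (sign p₀).resolve_left fun hn => absurd (hn s₀) (not_le.mpr hs₀)
  have hneg : ∀ q s, T (Pi.single q 1) s ≤ 0 := by
    intro q
    refine (sign q).resolve_left fun hq => ?_
    have prop := mul_eq_mul_of_combination_mul_nonneg hq hp₀ (h q p₀)
    have hzero : T (T (Pi.single p₀ 1) s₀ • Pi.single q 1 -
        T (Pi.single q 1) s₀ • Pi.single p₀ 1) = 0 := by
      ext t
      simp only [map_sub, map_smul, Pi.sub_apply, Pi.smul_apply, smul_eq_mul, Pi.zero_apply]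
      linarith [prop s₀ t]
    rw [LinearEquiv.map_eq_zero_iff] at hzero
    have hqp : q ≠ p₀ := by
      rintro rfl
      exact absurd (hq s₀) (not_le.mpr hs₀)
    have := congrFun hzero q
    simp [hqp] at this
    exact hs₀.ne this
  obtain ⟨τ, c, hc, hT⟩ := exists_monomial_of_nonneg_of_symm_mul_nonneg
    (T.trans (LinearEquiv.neg ℝ)) (fun p s => by simpa using hneg p s)
    (fun p s t => by
      have : (T.trans (LinearEquiv.neg ℝ)).symm (Pi.single p 1) = -T.symm (Pi.single p 1) := by
        rw [LinearEquiv.symm_apply_eq]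
        simp
      simpa [this] using h' p s t)
  refine ⟨-1, Or.inr rfl, τ, c, hc, fun x s => ?_⟩
  rw [← hT]
  simp

end Monomial

section AdditiveMinor

theorem additiveMinor_mul_eq_of_lt {I J : Type*} [LinearOrder I] [LinearOrder J]
    {x y : I × J → ℝ} {X Y : ℝ}
    (h : ∀ i k j l, i < k → j < l → additiveMinor x i k j l * X = additiveMinor y i k j l * Y)
    (i k : I) (j l : J) : additiveMinor x i k j l * X = additiveMinor y i k j l * Y := by
  unfold additiveMinor at *
  rcases lt_trichotomy i k with hi | rfl | hi <;> rcases lt_trichotomy j l with hj | rfl | hj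
  · exact h i k j l hi hj
  · ring
  · linarith [h i k l j hi hj]
  · ring
  · ring
  · ring
  · linarith [h k i j l hi hj]
  · ring
  · linarith [h k i l j hi hj]

/-- Indicator function of a lower right corner of the index rectangle. -/
def cornerIndicator {m n : ℕ} (a b : ℕ) (p : Fin m × Fin n) : ℝ :=
  (if a ≤ (p.1 : ℕ) then 1 else 0) * (if b ≤ (p.2 : ℕ) then 1 else 0)

theorem single_eq_cornerIndicator {m n : ℕ} (q p : Fin m × Fin n) :
    (Pi.single q 1 : Fin m × Fin n → ℝ) p =
      cornerIndicator q.1 q.2 p - cornerIndicator (q.1 + 1) q.2 p -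
        cornerIndicator q.1 (q.2 + 1) p + cornerIndicator (q.1 + 1) (q.2 + 1) p := by
  have key : ∀ {k : ℕ} (a b : Fin k), (if a = b then (1 : ℝ) else 0) =
      (if (a : ℕ) ≤ b then 1 else 0) - (if (a : ℕ) + 1 ≤ b then 1 else 0) := by
    intro k a b
    simp only [Fin.ext_iff]
    split_ifs <;> first | omega | simp
  have hs : (Pi.single q 1 : Fin m × Fin n → ℝ) p =
      (if q.1 = p.1 then 1 else 0) * (if q.2 = p.2 then 1 else 0) := by
    simp only [Pi.single_apply, Prod.ext_iff, eq_comm (a := p.1), eq_comm (a := p.2), ite_and,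
      ite_mul, one_mul, zero_mul]
  rw [hs, key, key]
  unfold cornerIndicator
  ring

theorem exists_not_mem_rectangle {m n : ℕ} (hm : 2 ≤ m) (hn : 2 ≤ n) (hmn : 3 ≤ m ∨ 3 ≤ n)
    (i k : Fin m) (j l : Fin n) :
    ∃ (i' k' : Fin m) (j' l' : Fin n), i' ≠ k' ∧ j' ≠ l' ∧
      ((i' ≠ i ∧ i' ≠ k) ∨ (j' ≠ j ∧ j' ≠ l)) := by
  have two : ∀ {s : ℕ}, 2 ≤ s → ∀ a : Fin s, ∃ b, a ≠ b := by
    intro s hs a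
    have : Nontrivial (Fin s) := Fin.nontrivial_iff_two_le.mpr hs
    obtain ⟨b, hb⟩ := exists_ne a
    exact ⟨b, hb.symm⟩
  have three : ∀ {s : ℕ}, 3 ≤ s → ∀ a b : Fin s, ∃ c, c ≠ a ∧ c ≠ b := fun hs a b =>
    Fin.exists_ne_and_ne_of_two_lt a b hs
  rcases hmn with h | h
  · obtain ⟨c, hc⟩ := three h i k
    obtain ⟨d, hd⟩ := two hm c
    obtain ⟨e, he⟩ := two hn j
    exact ⟨c, d, j, e, hd, he, Or.inl hc⟩
  · obtain ⟨c, hc⟩ := three h j l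
    obtain ⟨d, hd⟩ := two hn c
    obtain ⟨e, he⟩ := two hm i
    exact ⟨i, e, c, d, he, hd, Or.inr hc⟩

/-- If the additive minors of `w` are proportional to those of every rearranged corner indicator,
then they vanish. -/
theorem additiveMinor_eq_zero_of_proportional {m n : ℕ} (hm : 2 ≤ m) (hn : 2 ≤ n)
    (hmn : 3 ≤ m ∨ 3 ≤ n) (τ : Fin m × Fin n ≃ Fin m × Fin n) (w : Fin m × Fin n → ℝ)
    (h : ∀ (a b : ℕ) i k j l i' k' j' l', i < k → j < l → i' < k' → j' < l' →
      additiveMinor w i k j l * additiveMinor (cornerIndicator a b ∘ τ) i' k' j' l' =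
      additiveMinor w i' k' j' l' * additiveMinor (cornerIndicator a b ∘ τ) i k j l)
    (i k : Fin m) (j l : Fin n) : additiveMinor w i k j l = 0 := by
  obtain ⟨i', k', j', l', hi, hj, hp⟩ := exists_not_mem_rectangle hm hn hmn i k j l
  have h₁ : ∀ (a b : ℕ) i k j l, additiveMinor w i k j l *
      additiveMinor (cornerIndicator a b ∘ τ) i' k' j' l' =
      additiveMinor (cornerIndicator a b ∘ τ) i k j l * additiveMinor w i' k' j' l' := by
    intro a b
    refine additiveMinor_mul_eq_of_lt fun i k j l hik hjl => ?_
    have := additiveMinor_mul_eq_of_lt (x := w) (y := cornerIndicator a b ∘ τ)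
      (X := additiveMinor (cornerIndicator a b ∘ τ) i k j l) (Y := additiveMinor w i k j l)
      (fun i' k' j' l' hik' hjl' => by
        rw [h a b i' k' j' l' i k j l hik' hjl' hik hjl, mul_comm]) i' k' j' l'
    linarith
  have hsingle : ∀ p, (Pi.single (i', j') 1 : Fin m × Fin n → ℝ) p =
      (Pi.single (τ (i', j')) 1 : Fin m × Fin n → ℝ) (τ p) := by
    intro p
    simp [Pi.single_apply]
  have h₂ : additiveMinor w i k j l * additiveMinor (Pi.single (i', j') 1) i' k' j' l' =
      additiveMinor (Pi.single (i', j') 1) i k j l * additiveMinor w i' k' j' l' := by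
    have e1 := h₁ (τ (i', j')).1 (τ (i', j')).2 i k j l
    have e2 := h₁ ((τ (i', j')).1 + 1) (τ (i', j')).2 i k j l
    have e3 := h₁ (τ (i', j')).1 ((τ (i', j')).2 + 1) i k j l
    have e4 := h₁ ((τ (i', j')).1 + 1) ((τ (i', j')).2 + 1) i k j l
    simp only [additiveMinor, hsingle, single_eq_cornerIndicator, Function.comp_apply] at *
    linear_combination e1 - e2 - e3 + e4
  have e1 : additiveMinor (Pi.single (i', j') 1 : Fin m × Fin n → ℝ) i' k' j' l' = 1 := by
    simp [additiveMinor, hi.symm, hj.symm]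
  have e2 : additiveMinor (Pi.single (i', j') 1 : Fin m × Fin n → ℝ) i k j l = 0 := by
    rcases hp with ⟨h1, h2⟩ | ⟨h1, h2⟩ <;>
      simp [additiveMinor, h1.symm, h2.symm]
  rw [e1, e2] at h₂
  linarith

end AdditiveMinor

section Grid

variable {I J X Y : Type*}

theorem eq_or_eq_of_additiveMinor_eq_zero {φ : I × J → X}
    (h : ∀ r : X → ℝ, ∀ i k j l, additiveMinor (r ∘ φ) i k j l = 0) (i k : I) (j l : J) :
    (φ (i, j) = φ (i, l) ∧ φ (k, j) = φ (k, l)) ∨ (φ (i, j) = φ (k, j) ∧ φ (i, l) = φ (k, l)) := by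
  classical
  unfold additiveMinor at h
  have h₁ := h (fun x => if x = φ (i, j) then 1 else 0) i k j l
  have h₂ := h (fun x => if x = φ (k, l) then 1 else 0) i k j l
  simp only [Function.comp_apply, if_true] at h₁ h₂
  by_cases e : φ (i, l) = φ (i, j)
  · refine Or.inl ⟨e.symm, ?_⟩
    by_contra hne
    rw [e, if_neg hne] at h₂
    linarith
  · rw [if_neg e] at h₁
    have e' : φ (k, j) = φ (i, j) := by
      by_contra hne
      rw [if_neg hne] at h₁
      split_ifs at h₁ <;> linarith
    refine Or.inr ⟨e'.symm, ?_⟩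
    by_contra hne
    rw [e', if_neg hne] at h₂
    linarith

theorem separated_of_horizontal_edge [Nontrivial I] {φ : I × J → X} {ψ : I × J → Y}
    (hinj : Function.Injective fun p => (φ p, ψ p))
    (hφ : ∀ r : X → ℝ, ∀ i k j l, additiveMinor (r ∘ φ) i k j l = 0)
    (hψ : ∀ r : Y → ℝ, ∀ i k j l, additiveMinor (r ∘ ψ) i k j l = 0)
    {i₀ : I} {j₀ j₁ : J} (hj : j₀ ≠ j₁) (h₀ : φ (i₀, j₀) = φ (i₀, j₁)) :
    (∀ i j l, φ (i, j) = φ (i, l)) ∧ ∀ i k j, ψ (i, j) = ψ (k, j) := by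
  have horizontal : ∀ {i j l}, j ≠ l → φ (i, j) = φ (i, l) → ∀ k, ψ (i, j) = ψ (k, j) := by
    intro i j l hjl he k
    refine ((eq_or_eq_of_additiveMinor_eq_zero hψ i k j l).resolve_left fun h => hjl ?_).1
    exact (Prod.ext_iff.mp (hinj (Prod.ext he h.1))).2
  have vertical : ∀ {i k j}, i ≠ k → ψ (i, j) = ψ (k, j) → ∀ l,
      φ (i, j) = φ (i, l) ∧ φ (k, j) = φ (k, l) := by
    intro i k j hik he l
    refine (eq_or_eq_of_additiveMinor_eq_zero hφ i k j l).resolve_right fun h => hik ?_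
    exact (Prod.ext_iff.mp (hinj (Prod.ext h.1 he))).1
  have hcol := horizontal hj h₀
  have hrow : ∀ k l, φ (k, j₀) = φ (k, l) := by
    intro k l
    by_cases hk : k = i₀
    · obtain ⟨k', hk'⟩ := exists_ne i₀
      exact hk ▸ (vertical hk'.symm (hcol k') l).1
    · exact (vertical (Ne.symm hk) (hcol k) l).2
  refine ⟨fun i j l => (hrow i j).symm.trans (hrow i l), fun i k j => ?_⟩
  by_cases hjj : j = j₀
  · exact hjj ▸ (hcol i).symm.trans (hcol k)
  · exact horizontal hjj (hrow i j).symm k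

/-- A bijection of a grid preserving additive separability of functions permutes rows and columns,
possibly after exchanging their roles. -/
theorem separated_or_separated_swap [Nontrivial I] [Nontrivial J] {φ : I × J → X} {ψ : I × J → Y}
    (hinj : Function.Injective fun p => (φ p, ψ p))
    (hφ : ∀ r : X → ℝ, ∀ i k j l, additiveMinor (r ∘ φ) i k j l = 0)
    (hψ : ∀ r : Y → ℝ, ∀ i k j l, additiveMinor (r ∘ ψ) i k j l = 0) :
    ((∀ i j l, φ (i, j) = φ (i, l)) ∧ ∀ i k j, ψ (i, j) = ψ (k, j)) ∨
    ((∀ i j l, ψ (i, j) = ψ (i, l)) ∧ ∀ i k j, φ (i, j) = φ (k, j)) := by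
  obtain ⟨i₀, i₁, hi⟩ := exists_pair_ne I
  obtain ⟨j₀, j₁, hj⟩ := exists_pair_ne J
  have hinj' : Function.Injective fun p => (ψ p, φ p) := fun p q h =>
    hinj (Prod.ext (Prod.ext_iff.mp h).2 (Prod.ext_iff.mp h).1)
  rcases eq_or_eq_of_additiveMinor_eq_zero hφ i₀ i₁ j₀ j₁ with h | h
  · exact Or.inl (separated_of_horizontal_edge hinj hφ hψ hj h.1)
  · refine Or.inr (separated_of_horizontal_edge hinj' hψ hφ hj
      ((eq_or_eq_of_additiveMinor_eq_zero hψ i₀ i₁ j₀ j₁).resolve_right fun h' => hi ?_).1)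
    exact (Prod.ext_iff.mp (hinj (Prod.ext h.1 h'.1))).1

end Grid

theorem eq_id_or_eq_rev_of_mul_nonneg {n : ℕ} {α : Fin n → Fin n} (hα : Function.Injective α)
    (h : ∀ i k i' k', i < k → i' < k' →
      0 ≤ (((α k : ℕ) : ℝ) - (α i : ℕ)) * (((α k' : ℕ) : ℝ) - (α i' : ℕ))) :
    α = id ∨ α = Fin.rev := by
  have key : StrictMono α ∨ StrictMono (Fin.rev ∘ α) := by
    by_contra! hc
    simp only [StrictMono, not_forall, Function.comp_apply, Fin.rev_lt_rev, not_lt] at hc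
    obtain ⟨⟨i, k, hik, h1⟩, i', k', hik', h2⟩ := hc
    have h1' : α k < α i := lt_of_le_of_ne h1 (hα.ne hik.ne')
    have h2' : α i' < α k' := lt_of_le_of_ne h2 (hα.ne hik'.ne)
    have a1 : ((α k : ℕ) : ℝ) < (α i : ℕ) := by exact_mod_cast h1'
    have a2 : ((α i' : ℕ) : ℝ) < (α k' : ℕ) := by exact_mod_cast h2'
    nlinarith [h i k i' k' hik hik']
  refine key.imp (fun h => h.eq_id) fun h => ?_
  ext i
  have := congrFun h.eq_id i
  rw [Function.comp_apply, id, Fin.rev_eq_iff] at this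
  rw [this]

section Preservation

variable {m n : ℕ}

theorem exchangeMat_mul_apply (A : Matrix (Fin m) (Fin n) ℝ) (i : Fin m) (j : Fin n) :
    (exchangeMat m * A) i j = A i.rev j := by
  simp [exchangeMat, Matrix.mul_apply]

theorem mul_exchangeMat_apply (A : Matrix (Fin m) (Fin n) ℝ) (i : Fin m) (j : Fin n) :
    (A * exchangeMat n) i j = A i j.rev := by
  have h : ∀ b : Fin n, j = b.rev ↔ b = j.rev := fun b => by rw [eq_comm, Fin.rev_eq_iff]
  simp [exchangeMat, Matrix.mul_apply, h]

theorem diagonal_mul_mul_diagonal_apply (F : Fin m → ℝ) (E : Fin n → ℝ)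
    (A : Matrix (Fin m) (Fin n) ℝ) (i : Fin m) (j : Fin n) :
    (Matrix.diagonal F * A * Matrix.diagonal E) i j = F i * A i j * E j := by
  rw [Matrix.mul_diagonal, Matrix.diagonal_mul]

theorem IsSRk.of_minors {m' n' k : ℕ} {A : Matrix (Fin m) (Fin n) ℝ}
    {B : Matrix (Fin m') (Fin n') ℝ} (hA : IsSRk k A) (δ : ℕ → ℝ)
    (hδ : ∀ r, δ r = 1 ∨ δ r = -1)
    (h : ∀ r (f : Fin r → Fin m') (g : Fin r → Fin n'), StrictMono f → StrictMono g →
      ∃ (f' : Fin r → Fin m) (g' : Fin r → Fin n) (c : ℝ), StrictMono f' ∧ StrictMono g' ∧ 0 < c ∧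
        (B.submatrix f g).det = δ r * (c * (A.submatrix f' g').det)) : IsSRk k B := by
  intro r hr hrk
  obtain ⟨ε, hε, hmin⟩ := hA r hr hrk
  have hδ2 : δ r * δ r = 1 := by rcases hδ r with h | h <;> simp [h]
  refine ⟨ε * δ r, ?_, fun f g hf hg hne => ?_⟩
  · rcases hε with rfl | rfl <;> rcases hδ r with h | h <;> simp [h]
  · obtain ⟨f', g', c, hf', hg', hc, heq⟩ := h r f g hf hg
    rw [heq] at hne ⊢
    have hpos := mul_pos hc (hmin f' g' hf' hg' (right_ne_zero_of_mul (right_ne_zero_of_mul hne)))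
    calc 0 < c * (ε * (A.submatrix f' g').det) := hpos
      _ = (δ r * δ r) * (c * (ε * (A.submatrix f' g').det)) := by rw [hδ2, one_mul]
      _ = _ := by ring

theorem strictMono_rev_comp_rev {r s : ℕ} {f : Fin r → Fin s} (hf : StrictMono f) :
    StrictMono (Fin.rev ∘ f ∘ Fin.rev) := fun a b hab => by
  simpa using hf (Fin.rev_lt_rev.mpr hab)

theorem sign_revPerm_eq (r : ℕ) :
    ((Equiv.Perm.sign (Fin.revPerm : Equiv.Perm (Fin r)) : ℤ) : ℝ) = 1 ∨
      ((Equiv.Perm.sign (Fin.revPerm : Equiv.Perm (Fin r)) : ℤ) : ℝ) = -1 := by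
  rcases Int.units_eq_one_or (Equiv.Perm.sign (Fin.revPerm : Equiv.Perm (Fin r))) with h | h <;>
    simp [h]

theorem ElemSRMap.isSRk {k : ℕ} {T : Matrix (Fin m) (Fin n) ℝ → Matrix (Fin m) (Fin n) ℝ}
    (hT : ElemSRMap m n T) {A : Matrix (Fin m) (Fin n) ℝ} (hA : IsSRk k A) : IsSRk k (T A) := by
  rcases hT with ⟨F, E, hF, hE, rfl⟩ | rfl | rfl | rfl | ⟨rfl, rfl⟩
  · refine hA.of_minors (fun _ => 1) (fun _ => Or.inl rfl) fun r f g hf hg =>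
      ⟨f, g, (∏ i, F (f i)) * ∏ j, E (g j), hf, hg,
        mul_pos (Finset.prod_pos fun i _ => hF _) (Finset.prod_pos fun j _ => hE _), ?_⟩
    have : (Matrix.diagonal F * A * Matrix.diagonal E).submatrix f g =
        Matrix.diagonal (F ∘ f) * A.submatrix f g * Matrix.diagonal (E ∘ g) := by
      ext i j
      simp
    rw [this]
    simp only [Matrix.det_mul, Matrix.det_diagonal, Function.comp_apply]
    ring
  · refine hA.of_minors (fun r => (-1) ^ r) (fun r => neg_one_pow_eq_or ℝ r) fun r f g hf hg =>
      ⟨f, g, 1, hf, hg, one_pos, ?_⟩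
    have : (-A).submatrix f g = -A.submatrix f g := rfl
    simp only [this, Matrix.det_neg, Fintype.card_fin, one_mul]
  · refine hA.of_minors (fun r => ((Equiv.Perm.sign (Fin.revPerm : Equiv.Perm (Fin r)) : ℤ) : ℝ))
      sign_revPerm_eq fun r f g hf hg =>
      ⟨Fin.rev ∘ f ∘ Fin.rev, g, 1, strictMono_rev_comp_rev hf, hg, one_pos, ?_⟩
    rw [one_mul, ← Matrix.det_permute]
    congr 1
    ext i j
    simp [exchangeMat_mul_apply]
  · refine hA.of_minors (fun r => ((Equiv.Perm.sign (Fin.revPerm : Equiv.Perm (Fin r)) : ℤ) : ℝ))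
      sign_revPerm_eq fun r f g hf hg =>
      ⟨f, Fin.rev ∘ g ∘ Fin.rev, 1, hf, strictMono_rev_comp_rev hg, one_pos, ?_⟩
    rw [one_mul, ← Matrix.det_permute']
    congr 1
    ext i j
    simp [mul_exchangeMat_apply]
  · refine hA.of_minors (fun _ => 1) (fun _ => Or.inl rfl) fun r f g hf hg =>
      ⟨g, f, 1, hg, hf, one_pos, ?_⟩
    rw [one_mul, one_mul, ← Matrix.det_transpose]
    rfl

theorem ElemSRMap.exists_rightInverse
    {T : Matrix (Fin m) (Fin n) ℝ → Matrix (Fin m) (Fin n) ℝ} (hT : ElemSRMap m n T) :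
    ∃ T', ElemSRMap m n T' ∧ ∀ A, T (T' A) = A := by
  rcases hT with ⟨F, E, hF, hE, rfl⟩ | rfl | rfl | rfl | ⟨rfl, rfl⟩
  · refine ⟨_, Or.inl ⟨fun i => (F i)⁻¹, fun j => (E j)⁻¹, fun i => inv_pos.mpr (hF i),
      fun j => inv_pos.mpr (hE j), rfl⟩, fun A => ?_⟩
    ext i j
    have := (hF i).ne'
    have := (hE j).ne'
    simp only [diagonal_mul_mul_diagonal_apply]
    field_simp
  · exact ⟨_, Or.inr (Or.inl rfl), fun A => neg_neg A⟩
  · refine ⟨_, Or.inr (Or.inr (Or.inl rfl)), fun A => ?_⟩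
    ext i j
    simp only [exchangeMat_mul_apply, Fin.rev_rev]
  · refine ⟨_, Or.inr (Or.inr (Or.inr (Or.inl rfl))), fun A => ?_⟩
    ext i j
    simp only [mul_exchangeMat_apply, Fin.rev_rev]
  · exact ⟨_, Or.inr (Or.inr (Or.inr (Or.inr ⟨rfl, rfl⟩))), fun A => rfl⟩

theorem ElemSRMap.image_eq {T : Matrix (Fin m) (Fin n) ℝ → Matrix (Fin m) (Fin n) ℝ}
    (hT : ElemSRMap m n T) (k : ℕ) : T '' {A | IsSRk k A} = {A | IsSRk k A} := by
  obtain ⟨T', hT', hinv⟩ := hT.exists_rightInverse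
  refine Set.Subset.antisymm ?_ fun A hA => ⟨T' A, hT'.isSRk hA, hinv A⟩
  rintro _ ⟨A, hA, rfl⟩
  exact hT.isSRk hA

/-- Compositions of one or more elementary transformations. -/
def IsElemComp (m n : ℕ) (T : Matrix (Fin m) (Fin n) ℝ → Matrix (Fin m) (Fin n) ℝ) : Prop :=
  ∃ L : List (Matrix (Fin m) (Fin n) ℝ → Matrix (Fin m) (Fin n) ℝ),
    L ≠ [] ∧ (∀ T ∈ L, ElemSRMap m n T) ∧ T = L.foldr (· ∘ ·) id

theorem IsElemComp.image_eq {T : Matrix (Fin m) (Fin n) ℝ → Matrix (Fin m) (Fin n) ℝ}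
    (hT : IsElemComp m n T) (k : ℕ) : T '' {A | IsSRk k A} = {A | IsSRk k A} := by
  obtain ⟨L, -, hL, rfl⟩ := hT
  induction L with
  | nil => simp
  | cons T L ih =>
    rw [List.foldr_cons, Set.image_comp, ih fun T' hT' => hL T' (List.mem_cons_of_mem _ hT'),
      (hL T List.mem_cons_self).image_eq]

theorem ElemSRMap.isElemComp {T : Matrix (Fin m) (Fin n) ℝ → Matrix (Fin m) (Fin n) ℝ}
    (hT : ElemSRMap m n T) : IsElemComp m n T :=
  ⟨[T], by simp, by simpa using hT, rfl⟩

theorem IsElemComp.comp {T T' : Matrix (Fin m) (Fin n) ℝ → Matrix (Fin m) (Fin n) ℝ}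
    (hT : IsElemComp m n T) (hT' : IsElemComp m n T') : IsElemComp m n (T ∘ T') := by
  obtain ⟨L, hne, hL, rfl⟩ := hT
  obtain ⟨L', -, hL', rfl⟩ := hT'
  refine ⟨L ++ L', by simp [hne], fun T hT => (List.mem_append.mp hT).elim (hL T) (hL' T), ?_⟩
  clear hne hL
  induction L with
  | nil => rfl
  | cons T L ih => rw [List.cons_append, List.foldr_cons, List.foldr_cons, ← ih]; rfl

theorem isElemComp_scale_reverse {ε : ℝ} (hε : ε = 1 ∨ ε = -1) {F : Fin m → ℝ} {E : Fin n → ℝ}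
    (hF : ∀ i, 0 < F i) (hE : ∀ j, 0 < E j) {α : Fin m → Fin m} {β : Fin n → Fin n}
    (hα : α = id ∨ α = Fin.rev) (hβ : β = id ∨ β = Fin.rev) :
    IsElemComp m n fun A => Matrix.of fun i j => ε * (F i * E j * A (α i) (β j)) := by
  have hdiag : IsElemComp m n fun A => Matrix.diagonal F * A * Matrix.diagonal E :=
    ElemSRMap.isElemComp (Or.inl ⟨F, E, hF, hE, rfl⟩)
  have hneg : IsElemComp m n fun A => Matrix.of fun i j => ε * (F i * E j * A i j) := by
    rcases hε with rfl | rfl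
    · convert hdiag using 1
      ext A i j
      simp only [diagonal_mul_mul_diagonal_apply, Matrix.of_apply]
      ring
    · convert (ElemSRMap.isElemComp (Or.inr (Or.inl rfl))).comp hdiag using 1
      ext A i j
      simp only [diagonal_mul_mul_diagonal_apply, Matrix.of_apply, Function.comp_apply,
        Matrix.neg_apply]
      ring
  have hrow : IsElemComp m n fun A => Matrix.of fun i j => ε * (F i * E j * A (α i) j) := by
    rcases hα with rfl | rfl
    · exact hneg
    · convert hneg.comp (ElemSRMap.isElemComp (Or.inr (Or.inr (Or.inl rfl)))) using 1
      ext A i j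
      simp only [Matrix.of_apply, Function.comp_apply, exchangeMat_mul_apply]
  rcases hβ with rfl | rfl
  · exact hrow
  · convert hrow.comp (ElemSRMap.isElemComp (Or.inr (Or.inr (Or.inr (Or.inl rfl))))) using 1
    ext A i j
    simp only [Matrix.of_apply, Function.comp_apply, mul_exchangeMat_apply]

theorem isElemComp_scale_reverse_transpose {ε : ℝ} (hε : ε = 1 ∨ ε = -1) {F E : Fin n → ℝ}
    (hF : ∀ i, 0 < F i) (hE : ∀ j, 0 < E j) {α β : Fin n → Fin n}
    (hα : α = id ∨ α = Fin.rev) (hβ : β = id ∨ β = Fin.rev) :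
    IsElemComp n n fun A => Matrix.of fun i j => ε * (F i * E j * A (α j) (β i)) :=
  (isElemComp_scale_reverse hε hF hE hβ hα).comp
    (ElemSRMap.isElemComp (Or.inr (Or.inr (Or.inr (Or.inr ⟨rfl, rfl⟩)))))

end Preservation

section TestMatrices

variable {m n : ℕ}

theorem isSR_single_add_smul_single (i₀ i₁ : Fin m) (j₀ j₁ : Fin n) {a : ℝ} (ha : 0 ≤ a) :
    IsSR (Matrix.of fun i j => (Pi.single (i₀, j₀) 1 + a • Pi.single (i₁, j₁) 1 :
      Fin m × Fin n → ℝ) (i, j)) := by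
  have wedge : ∀ {s : ℕ} (p q : Fin s) (b : ℝ), 0 ≤ b →
      (∀ i k, i < k → 0 ≤ (if i = p then (1 : ℝ) else 0) * (if k = q then b else 0) -
        (if k = p then (1 : ℝ) else 0) * (if i = q then b else 0)) ∨
      (∀ i k, i < k → (if i = p then (1 : ℝ) else 0) * (if k = q then b else 0) -
        (if k = p then (1 : ℝ) else 0) * (if i = q then b else 0) ≤ 0) := by
    intro s p q b hb
    rcases le_total p q with h | h
    · refine Or.inl fun i k hik => ?_
      have : ¬(k = p ∧ i = q) := by rintro ⟨rfl, rfl⟩; exact absurd hik (not_lt.mpr h)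
      split_ifs <;> simp_all
    · refine Or.inr fun i k hik => ?_
      have : ¬(i = p ∧ k = q) := by rintro ⟨rfl, rfl⟩; exact absurd hik (not_lt.mpr h)
      split_ifs <;> simp_all
  refine isSRk_of_rank_two _ (fun i => if i = i₀ then 1 else 0) (fun i => if i = i₁ then a else 0)
    (fun j => if j = j₀ then 1 else 0) (fun j => if j = j₁ then 1 else 0) (fun i j => ?_)
    (fun i j => ?_) (wedge _ _ _ ha) (wedge _ _ _ zero_le_one)
  · simp only [Matrix.of_apply, Pi.add_apply, Pi.smul_apply, Pi.single_apply, Prod.ext_iff,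
      ite_and, smul_eq_mul, mul_ite, mul_one, mul_zero]
    split_ifs <;> simp
  · simp only [Matrix.of_apply, Pi.add_apply, Pi.smul_apply, Pi.single_apply, smul_eq_mul]
    split_ifs <;> simp [ha]
    linarith

theorem isSR_exp_add_corner (r : Fin m → ℝ) (s : Fin n → ℝ) (t : ℝ) (a b : ℕ) :
    IsSR (Matrix.of fun i j => Real.exp (r i + s j + t * cornerIndicator a b (i, j))) := by
  have mono : ∀ {k : ℕ} (a : ℕ) (i k : Fin k), i < k →
      (if a ≤ (i : ℕ) then (1 : ℝ) else 0) ≤ (if a ≤ (k : ℕ) then 1 else 0) := by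
    intro _ a i k hik
    have : (i : ℕ) < k := hik
    split_ifs <;> first | omega | simp
  refine isSRk_of_rank_two _ (fun i => Real.exp (r i))
    (fun i => Real.exp (r i) * if a ≤ (i : ℕ) then 1 else 0) (fun j => Real.exp (s j))
    (fun j => Real.exp (s j) * (Real.exp t - 1) * if b ≤ (j : ℕ) then 1 else 0) (fun i j => ?_)
    (fun i j => (Real.exp_pos _).le) (Or.inl fun i k hik => ?_) ?_
  · simp only [Matrix.of_apply, cornerIndicator, Real.exp_add]
    split_ifs <;> simp
    ring
  · have := mul_nonneg (mul_pos (Real.exp_pos (r i)) (Real.exp_pos (r k))).le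
      (sub_nonneg.mpr (mono a i k hik))
    linarith
  · have key : ∀ j l : Fin n, j < l → 0 ≤ (Real.exp (s j) * Real.exp (s l)) *
        ((if b ≤ (l : ℕ) then (1 : ℝ) else 0) - (if b ≤ (j : ℕ) then 1 else 0)) := fun j l hjl =>
      mul_nonneg (mul_pos (Real.exp_pos _) (Real.exp_pos _)).le (sub_nonneg.mpr (mono b j l hjl))
    rcases le_total 1 (Real.exp t) with h | h
    · refine Or.inl fun j l hjl => ?_
      have := mul_nonneg (key j l hjl) (sub_nonneg.mpr h)
      linarith
    · refine Or.inr fun j l hjl => ?_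
      have := mul_nonneg (key j l hjl) (sub_nonneg.mpr h)
      linarith

theorem isSR_one_add_mul :
    IsSR (Matrix.of fun (i : Fin m) (j : Fin n) => 1 + ((i : ℕ) : ℝ) * ((j : ℕ) : ℝ)) := by
  refine isSRk_of_rank_two _ (fun _ => 1) (fun i => ((i : ℕ) : ℝ)) (fun _ => 1)
    (fun j => ((j : ℕ) : ℝ)) (fun i j => by simp)
    (fun i j => by rw [Matrix.of_apply]; positivity) (Or.inl fun i k hik => ?_)
    (Or.inl fun j l hjl => ?_)
  · have : ((i : ℕ) : ℝ) < (k : ℕ) := by exact_mod_cast hik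
    linarith
  · have : ((j : ℕ) : ℝ) < (l : ℕ) := by exact_mod_cast hjl
    linarith

end TestMatrices

theorem mul_nonneg_of_exp_sub_mul_nonneg {p q p' q' : ℝ}
    (h : 0 ≤ (Real.exp p - Real.exp q) * (Real.exp p' - Real.exp q')) :
    0 ≤ (p - q) * (p' - q') := by
  by_contra! hlt
  refine absurd h (not_le.mpr ?_)
  rw [mul_neg_iff] at hlt ⊢
  simpa only [sub_pos, sub_neg, Real.exp_lt_exp] using hlt

theorem additiveMinor_mul_nonneg {m n : ℕ} {y : Fin m × Fin n → ℝ}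
    (hy : IsSRk 2 (Matrix.of fun i j => Real.exp (y (i, j)))) {i k i' k' : Fin m} {j l j' l' : Fin n}
    (hik : i < k) (hjl : j < l) (hik' : i' < k') (hjl' : j' < l') :
    0 ≤ additiveMinor y i k j l * additiveMinor y i' k' j' l' := by
  have h := hy.minor_mul_minor_nonneg le_rfl hik hjl hik' hjl'
  simp only [Matrix.of_apply, ← Real.exp_add] at h
  have := mul_nonneg_of_exp_sub_mul_nonneg h
  unfold additiveMinor
  linarith

section Rearrangement

variable {m n : ℕ} {τ : Fin m × Fin n ≃ Fin m × Fin n} {c : Fin m × Fin n → ℝ}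

theorem additiveMinor_affine_mul_nonneg (hc : ∀ p, 0 < c p)
    (h : ∀ A : Matrix (Fin m) (Fin n) ℝ, IsSR A →
      IsSRk 2 (Matrix.of fun i j => c (i, j) * A (τ (i, j)).1 (τ (i, j)).2))
    (r : Fin m → ℝ) (s : Fin n → ℝ) (t u : ℝ) (a b : ℕ)
    {i k i' k' : Fin m} {j l j' l' : Fin n}
    (hik : i < k) (hjl : j < l) (hik' : i' < k') (hjl' : j' < l') :
    0 ≤ (additiveMinor (Real.log ∘ c) i k j l +
        t * additiveMinor ((fun p : Fin m × Fin n => r p.1 + s p.2) ∘ τ) i k j l +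
        u * additiveMinor (cornerIndicator a b ∘ τ) i k j l) *
      (additiveMinor (Real.log ∘ c) i' k' j' l' +
        t * additiveMinor ((fun p : Fin m × Fin n => r p.1 + s p.2) ∘ τ) i' k' j' l' +
        u * additiveMinor (cornerIndicator a b ∘ τ) i' k' j' l') := by
  have hsr := h _ (isSR_exp_add_corner (fun i => t * r i) (fun j => t * s j) u a b)
  have := additiveMinor_mul_nonneg
    (y := fun p => Real.log (c p) +
      (t * r (τ p).1 + t * s (τ p).2 + u * cornerIndicator a b (τ p)))
    (by simpa only [Real.exp_add _ (_ + _), Real.exp_log (hc _), Matrix.of_apply, Prod.mk.eta]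
      using hsr) hik hjl hik' hjl'
  convert this using 1
  simp only [additiveMinor, Function.comp_apply]
  ring

theorem additiveMinor_log_eq_zero (hm : 2 ≤ m) (hn : 2 ≤ n) (hmn : 3 ≤ m ∨ 3 ≤ n)
    (hc : ∀ p, 0 < c p)
    (h : ∀ A : Matrix (Fin m) (Fin n) ℝ, IsSR A →
      IsSRk 2 (Matrix.of fun i j => c (i, j) * A (τ (i, j)).1 (τ (i, j)).2))
    (i k : Fin m) (j l : Fin n) : additiveMinor (Real.log ∘ c) i k j l = 0 := by
  refine additiveMinor_eq_zero_of_proportional hm hn hmn τ _ (fun a b i k j l i' k' j' l'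
    hik hjl hik' hjl' => mul_eq_mul_of_forall_affine_mul_nonneg fun u => ?_) i k j l
  simpa using additiveMinor_affine_mul_nonneg hc h 0 0 0 u a b hik hjl hik' hjl'

theorem additiveMinor_separable_comp_eq_zero (hm : 2 ≤ m) (hn : 2 ≤ n) (hmn : 3 ≤ m ∨ 3 ≤ n)
    (hc : ∀ p, 0 < c p)
    (h : ∀ A : Matrix (Fin m) (Fin n) ℝ, IsSR A →
      IsSRk 2 (Matrix.of fun i j => c (i, j) * A (τ (i, j)).1 (τ (i, j)).2))
    (r : Fin m → ℝ) (s : Fin n → ℝ) (i k : Fin m) (j l : Fin n) :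
    additiveMinor ((fun p : Fin m × Fin n => r p.1 + s p.2) ∘ τ) i k j l = 0 := by
  refine additiveMinor_eq_zero_of_proportional hm hn hmn τ _ (fun a b i k j l i' k' j' l'
    hik hjl hik' hjl' => ?_) i k j l
  have key := mul_eq_mul_of_forall_affine_mul_nonneg fun t => by
    have := additiveMinor_affine_mul_nonneg hc h r s t 1 a b hik hjl hik' hjl'
    simpa only [additiveMinor_log_eq_zero hm hn hmn hc h, zero_add, one_mul,
      add_comm (t * _)] using this
  linarith

theorem mul_eq_mul_of_additiveMinor_log_eq_zero (hc : ∀ p, 0 < c p)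
    (h : ∀ i k j l, additiveMinor (Real.log ∘ c) i k j l = 0) (i k : Fin m) (j l : Fin n) :
    c (i, j) * c (k, l) = c (i, l) * c (k, j) := by
  have h0 := h i k j l
  simp only [additiveMinor, Function.comp_apply] at h0
  refine Real.log_injOn_pos (mul_pos (hc _) (hc _)) (mul_pos (hc _) (hc _)) ?_
  rw [Real.log_mul (hc _).ne' (hc _).ne', Real.log_mul (hc _).ne' (hc _).ne']
  linarith

theorem exists_factorization (hm : 0 < m) (hn : 0 < n) (hc : ∀ p, 0 < c p)
    (h : ∀ i k j l, c (i, j) * c (k, l) = c (i, l) * c (k, j)) :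
    ∃ (F : Fin m → ℝ) (E : Fin n → ℝ), (∀ i, 0 < F i) ∧ (∀ j, 0 < E j) ∧
      ∀ i j, c (i, j) = F i * E j := by
  refine ⟨fun i => c (i, ⟨0, hn⟩) / c (⟨0, hm⟩, ⟨0, hn⟩), fun j => c (⟨0, hm⟩, j),
    fun i => div_pos (hc _) (hc _), fun j => hc _, fun i j => ?_⟩
  have := (hc (⟨0, hm⟩, ⟨0, hn⟩)).ne'
  field_simp
  linarith [h i ⟨0, hm⟩ j ⟨0, hn⟩]

theorem test_minor_mul_nonneg (hc : ∀ p, 0 < c p)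
    (hmul : ∀ i k j l, c (i, j) * c (k, l) = c (i, l) * c (k, j))
    (h : ∀ A : Matrix (Fin m) (Fin n) ℝ, IsSR A →
      IsSRk 2 (Matrix.of fun i j => c (i, j) * A (τ (i, j)).1 (τ (i, j)).2))
    {x : Fin m → Fin n → ℝ}
    (hx : ∀ i j, x i j = 1 + (((τ (i, j)).1 : ℕ) : ℝ) * (((τ (i, j)).2 : ℕ) : ℝ))
    {i k i' k' : Fin m} {j l j' l' : Fin n}
    (hik : i < k) (hjl : j < l) (hik' : i' < k') (hjl' : j' < l') :
    0 ≤ (x i j * x k l - x i l * x k j) * (x i' j' * x k' l' - x i' l' * x k' j') := by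
  have h0 := (h _ isSR_one_add_mul).minor_mul_minor_nonneg le_rfl hik hjl hik' hjl'
  simp only [Matrix.of_apply, ← hx] at h0
  have e : ∀ i k j l, c (i, j) * x i j * (c (k, l) * x k l) - c (i, l) * x i l * (c (k, j) * x k j)
      = c (i, j) * c (k, l) * (x i j * x k l - x i l * x k j) := by
    intro i k j l
    linear_combination x i l * x k j * hmul i k j l
  rw [e, e] at h0
  have hpos : 0 < c (i, j) * c (k, l) * (c (i', j') * c (k', l')) :=
    mul_pos (mul_pos (hc _) (hc _)) (mul_pos (hc _) (hc _))
  refine nonneg_of_mul_nonneg_right (a := c (i, j) * c (k, l) * (c (i', j') * c (k', l'))) ?_ hpos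
  linarith

/-- The rearrangement underlying a monomial map preserving sign regularity consists of reversals,
possibly after a transposition. -/
theorem isElemComp_of_rearrangement (hm : 2 ≤ m) (hn : 2 ≤ n) (hmn : 3 ≤ m ∨ 3 ≤ n)
    (hc : ∀ p, 0 < c p)
    (h : ∀ A : Matrix (Fin m) (Fin n) ℝ, IsSR A →
      IsSRk 2 (Matrix.of fun i j => c (i, j) * A (τ (i, j)).1 (τ (i, j)).2))
    {ε : ℝ} (hε : ε = 1 ∨ ε = -1) :
    IsElemComp m n fun A => Matrix.of fun i j =>
      ε * (c (i, j) * A (τ (i, j)).1 (τ (i, j)).2) := by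
  have : Nontrivial (Fin m) := Fin.nontrivial_iff_two_le.mpr hm
  have : Nontrivial (Fin n) := Fin.nontrivial_iff_two_le.mpr hn
  have hmul := mul_eq_mul_of_additiveMinor_log_eq_zero hc
    (additiveMinor_log_eq_zero hm hn hmn hc h)
  obtain ⟨F, E, hF, hE, hFE⟩ := exists_factorization (by omega) (by omega) hc hmul
  have hsep := additiveMinor_separable_comp_eq_zero hm hn hmn hc h
  have hφ : ∀ r : Fin m → ℝ, ∀ i k j l, additiveMinor (r ∘ fun p => (τ p).1) i k j l = 0 := by
    intro r i k j l
    simpa [additiveMinor] using hsep r 0 i k j l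
  have hψ : ∀ s : Fin n → ℝ, ∀ i k j l, additiveMinor (s ∘ fun p => (τ p).2) i k j l = 0 := by
    intro s i k j l
    simpa [additiveMinor] using hsep 0 s i k j l
  obtain ⟨i₀, i₁, hi⟩ : ∃ i₀ i₁ : Fin m, i₀ < i₁ := ⟨⟨0, by omega⟩, ⟨1, by omega⟩, by simp⟩
  obtain ⟨j₀, j₁, hj⟩ : ∃ j₀ j₁ : Fin n, j₀ < j₁ := ⟨⟨0, by omega⟩, ⟨1, by omega⟩, by simp⟩
  have cast_ne : ∀ {s : ℕ} {a b : Fin s}, a ≠ b → ((a : ℕ) : ℝ) - (b : ℕ) ≠ 0 := by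
    intro s a b hab h0
    exact hab (Fin.ext (by exact_mod_cast sub_eq_zero.mp h0))
  rcases separated_or_separated_swap τ.injective hφ hψ with ⟨h1, h2⟩ | ⟨h2, h1⟩
  · obtain ⟨α, hα⟩ : ∃ α : Fin m → Fin m, ∀ i j, (τ (i, j)).1 = α i :=
      ⟨fun i => (τ (i, j₀)).1, fun i j => h1 i j j₀⟩
    obtain ⟨β, hβ⟩ : ∃ β : Fin n → Fin n, ∀ i j, (τ (i, j)).2 = β j :=
      ⟨fun j => (τ (i₀, j)).2, fun i j => h2 i i₀ j⟩
    have hαinj : Function.Injective α := fun i k hik =>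
      (Prod.ext_iff.mp (τ.injective (Prod.ext ((hα i j₀).trans (hik.trans (hα k j₀).symm))
        ((hβ i j₀).trans (hβ k j₀).symm)))).1
    have hβinj : Function.Injective β := fun j l hjl =>
      (Prod.ext_iff.mp (τ.injective (Prod.ext ((hα i₀ j).trans (hα i₀ l).symm)
        ((hβ i₀ j).trans (hjl.trans (hβ i₀ l).symm))))).2
    have prod := @test_minor_mul_nonneg m n τ c hc hmul h
      (fun i j => 1 + ((α i : ℕ) : ℝ) * ((β j : ℕ) : ℝ)) (fun i j => by rw [hα, hβ])
    simp only [hFE, hα, hβ]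
    refine isElemComp_scale_reverse hε hF hE
      (eq_id_or_eq_rev_of_mul_nonneg hαinj fun i k i' k' hik hik' => ?_)
      (eq_id_or_eq_rev_of_mul_nonneg hβinj fun j l j' l' hjl hjl' => ?_)
    · refine nonneg_of_mul_nonneg_right (a := (((β j₁ : ℕ) : ℝ) - (β j₀ : ℕ)) ^ 2) ?_
        (pow_two_pos_of_ne_zero (cast_ne (hβinj.ne hj.ne')))
      linarith [prod hik hj hik' hj]
    · refine nonneg_of_mul_nonneg_right (a := (((α i₁ : ℕ) : ℝ) - (α i₀ : ℕ)) ^ 2) ?_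
        (pow_two_pos_of_ne_zero (cast_ne (hαinj.ne hi.ne')))
      linarith [prod hi hjl hi hjl']
  · obtain ⟨α, hα⟩ : ∃ α : Fin n → Fin m, ∀ i j, (τ (i, j)).1 = α j :=
      ⟨fun j => (τ (i₀, j)).1, fun i j => h1 i i₀ j⟩
    obtain ⟨β, hβ⟩ : ∃ β : Fin m → Fin n, ∀ i j, (τ (i, j)).2 = β i :=
      ⟨fun i => (τ (i, j₀)).2, fun i j => h2 i j j₀⟩
    have hαinj : Function.Injective α := fun j l hjl =>
      (Prod.ext_iff.mp (τ.injective (Prod.ext ((hα i₀ j).trans (hjl.trans (hα i₀ l).symm))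
        ((hβ i₀ j).trans (hβ i₀ l).symm)))).2
    have hβinj : Function.Injective β := fun i k hik =>
      (Prod.ext_iff.mp (τ.injective (Prod.ext ((hα i j₀).trans (hα k j₀).symm)
        ((hβ i j₀).trans (hik.trans (hβ k j₀).symm))))).1
    obtain rfl : m = n := le_antisymm (by simpa using Fintype.card_le_of_injective β hβinj)
      (by simpa using Fintype.card_le_of_injective α hαinj)
    have prod := @test_minor_mul_nonneg m m τ c hc hmul h
      (fun i j => 1 + ((α j : ℕ) : ℝ) * ((β i : ℕ) : ℝ)) (fun i j => by rw [hα, hβ])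
    simp only [hFE, hα, hβ]
    refine isElemComp_scale_reverse_transpose hε hF hE
      (eq_id_or_eq_rev_of_mul_nonneg hαinj fun j l j' l' hjl hjl' => ?_)
      (eq_id_or_eq_rev_of_mul_nonneg hβinj fun i k i' k' hik hik' => ?_)
    · refine nonneg_of_mul_nonneg_right (a := (((β i₁ : ℕ) : ℝ) - (β i₀ : ℕ)) ^ 2) ?_
        (pow_two_pos_of_ne_zero (cast_ne (hβinj.ne hi.ne')))
      linarith [prod hi hjl hi hjl']
    · refine nonneg_of_mul_nonneg_right (a := (((α j₁ : ℕ) : ℝ) - (α j₀ : ℕ)) ^ 2) ?_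
        (pow_two_pos_of_ne_zero (cast_ne (hαinj.ne hj.ne')))
      linarith [prod hik hj hik' hj]

end Rearrangement

theorem isElemComp_of_image_eq {m n : ℕ} (hm : 2 ≤ m) (hn : 2 ≤ n) (hmn : 3 ≤ m ∨ 3 ≤ n)
    (𝓛 : Matrix (Fin m) (Fin n) ℝ →ₗ[ℝ] Matrix (Fin m) (Fin n) ℝ)
    {S : Set (Matrix (Fin m) (Fin n) ℝ)} (hSR : ∀ A, IsSR A → A ∈ S)
    (hS : ∀ A ∈ S, IsSRk 2 A) (himg : ⇑𝓛 '' S = S) : IsElemComp m n ⇑𝓛 := by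
  let e : Matrix (Fin m) (Fin n) ℝ ≃ₗ[ℝ] (Fin m × Fin n → ℝ) :=
    (LinearEquiv.curry ℝ ℝ (Fin m) (Fin n)).symm
  have htest : ∀ (p q : Fin m × Fin n) (a : ℝ), 0 ≤ a →
      e.symm (Pi.single p 1 + a • Pi.single q 1) ∈ S := fun p q a ha =>
    hSR _ (isSR_single_add_smul_single p.1 q.1 p.2 q.2 ha)
  have hsingle : ∀ p : Fin m × Fin n, e.symm (Pi.single p 1) ∈ S := fun p => by
    simpa using htest p p 0 le_rfl
  have hsurj : Function.Surjective 𝓛 := by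
    intro A
    have hmem : ∀ p : Fin m × Fin n, e.symm (Pi.single p 1) ∈ LinearMap.range 𝓛 := by
      intro p
      obtain ⟨B, -, hB⟩ := himg.ge (hsingle p)
      exact ⟨B, hB⟩
    have : A = ∑ p, e A p • e.symm (Pi.single p 1) := by
      apply e.injective
      rw [map_sum]
      simpa using pi_eq_sum_univ' (e A)
    rw [this]
    exact Submodule.sum_mem _ fun p _ => Submodule.smul_mem _ _ (hmem p)
  have hinj : Function.Injective 𝓛 := LinearMap.injective_iff_surjective.mpr hsurj
  let T := e.symm.trans ((LinearEquiv.ofBijective 𝓛 ⟨hinj, hsurj⟩).trans e)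
  have hT : ∀ x, T x = e (𝓛 (e.symm x)) := fun x => rfl
  have hL : ∀ A ∈ S, 𝓛 A ∈ S := fun A hA => himg ▸ Set.mem_image_of_mem _ hA
  obtain ⟨ε, hε, τ, c, hc, hTc⟩ := exists_monomial_of_mul_nonneg T
    (fun p q a ha s t => (hS _ (hL _ (htest p q a ha))).entry_mul_entry_nonneg one_le_two _ _ _ _)
    (fun p s t => by
      obtain ⟨B, hB, hBp⟩ := himg.ge (hsingle p)
      have : T.symm (Pi.single p 1) = e B := by
        rw [LinearEquiv.symm_apply_eq, hT, e.symm_apply_apply, hBp, e.apply_symm_apply]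
      rw [this]
      exact (hS B hB).entry_mul_entry_nonneg one_le_two _ _ _ _)
  have hform : ∀ A : Matrix (Fin m) (Fin n) ℝ,
      𝓛 A = Matrix.of fun i j => ε * (c (i, j) * A (τ (i, j)).1 (τ (i, j)).2) := by
    intro A
    ext i j
    exact hTc (e A) (i, j)
  have hε2 : ε * ε = 1 := by rcases hε with rfl | rfl <;> norm_num
  convert isElemComp_of_rearrangement (τ := τ) hm hn hmn hc (fun A hA => ?_) hε using 1
  · exact funext hform
  · have hsr : IsSRk 2 (𝓛 A) := hS _ (hL _ (hSR A hA))
    rcases hε with rfl | rfl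
    · simpa [hform] using hsr
    · convert (ElemSRMap.isSRk (Or.inr (Or.inl rfl)) hsr : IsSRk 2 (-𝓛 A)) using 1
      ext i j
      simp [hform]

/-- Theorem A (statement 0): for `m = n ≥ 3`, or `m ≠ n` with `m, n ≥ 2`, a
linear map `𝓛 : ℝ^{m×n} → ℝ^{m×n}` maps the SR matrices onto themselves iff it
maps the SR₂ matrices onto themselves, iff it is a composition of one or more
elementary transformations (a)–(e). -/
theorem sr_linear_preserver (m n : ℕ)
    (hmn : (m = n ∧ 3 ≤ m) ∨ (m ≠ n ∧ 2 ≤ m ∧ 2 ≤ n))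
    (𝓛 : Matrix (Fin m) (Fin n) ℝ →ₗ[ℝ] Matrix (Fin m) (Fin n) ℝ) :
    ((⇑𝓛 '' {A | IsSR A} = {A | IsSR A}) ↔
      (⇑𝓛 '' {A | IsSRk 2 A} = {A | IsSRk 2 A})) ∧
    ((⇑𝓛 '' {A | IsSRk 2 A} = {A | IsSRk 2 A}) ↔
      (∃ L : List (Matrix (Fin m) (Fin n) ℝ → Matrix (Fin m) (Fin n) ℝ),
        L ≠ [] ∧ (∀ T ∈ L, ElemSRMap m n T) ∧ ⇑𝓛 = L.foldr (· ∘ ·) id)) := by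
  obtain ⟨hm, hn, hmn⟩ : 2 ≤ m ∧ 2 ≤ n ∧ (3 ≤ m ∨ 3 ≤ n) := by omega
  have hSR : (⇑𝓛 '' {A | IsSR A} = {A | IsSR A}) ↔ IsElemComp m n ⇑𝓛 :=
    ⟨isElemComp_of_image_eq hm hn hmn 𝓛 (fun A hA => hA)
      (fun A hA r hr hr2 => hA r hr (hr2.trans (le_min hm hn))), fun h => h.image_eq _⟩
  have hSR₂ : (⇑𝓛 '' {A | IsSRk 2 A} = {A | IsSRk 2 A}) ↔ IsElemComp m n ⇑𝓛 :=
    ⟨isElemComp_of_image_eq hm hn hmn 𝓛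
      (fun A hA r hr hr2 => hA r hr (hr2.trans (le_min hm hn))) (fun A hA => hA),
      fun h => h.image_eq _⟩
  exact ⟨hSR.trans hSR₂.symm, hSR₂⟩
end

section
/- Let 𝓛 : ℝ^{2×2} → ℝ^{2×2} be a linear map. Then the following are equivalent: (1) 𝓛 maps the set of 2×2 SR matrices onto itself; (2) 𝓛 maps the set of 2×2 SR₁ matrices onto itself; (3) 𝓛 is a composition of one or more of the following transformations: (a) A ↦ H ∘ A (entrywise Hadamard product), where H is a 2×2 matrix with all entries positive; (b) A ↦ −A; (c) A ↦ P₂·A, where P₂ is the 2×2 exchange matrix; (d) A ↦ Aᵀ; and (e) the map sending the matrix with rows (a₁₁, a₁₂) and (a₂₁, a₂₂) to the matrix with rows (a₁₁, a₁₂) and (a₂₂, a₂₁). -/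
open Matrix

/-- The elementary transformations (a)–(e) of the `2 × 2` theorem:
positive entrywise (Hadamard) scaling, negation, left multiplication by the
exchange matrix, transposition, and swapping the two entries of the bottom
row. -/
def Elem2Map (T : Matrix (Fin 2) (Fin 2) ℝ → Matrix (Fin 2) (Fin 2) ℝ) : Prop :=
  (∃ H : Matrix (Fin 2) (Fin 2) ℝ, (∀ i j, 0 < H i j) ∧
      T = fun A => Matrix.of fun i j => H i j * A i j) ∨
  (T = fun A => -A) ∨
  (T = fun A => exchangeMat 2 * A) ∨
  (T = fun A => A.transpose) ∨
  (T = fun A => !![A 0 0, A 0 1; A 1 1, A 1 0])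

section SignCone

variable {ι : Type*} [Fintype ι]

theorem eq_zero_of_signed_of_sum_eq_zero {u : ι → ℝ} (hu : 0 ≤ u ∨ u ≤ 0)
    (hs : ∑ j, u j = 0) : u = 0 := by
  rcases hu with h | h
  · exact (Fintype.sum_eq_zero_iff_of_nonneg h).1 hs
  · exact (Fintype.sum_eq_zero_iff_of_nonpos h).1 hs

theorem nonneg_of_signed_of_sum_nonneg {u : ι → ℝ} (hu : 0 ≤ u ∨ u ≤ 0)
    (hs : 0 ≤ ∑ j, u j) : 0 ≤ u := by
  rcases hu with h | h
  · exact h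
  · have hle : ∑ j, u j ≤ 0 := Finset.sum_nonpos fun j _ => h j
    exact (eq_zero_of_signed_of_sum_eq_zero (Or.inr h) (le_antisymm hle hs)).ge

theorem nonneg_iff_of_signed_iff {M : (ι → ℝ) →ₗ[ℝ] (ι → ℝ)} (hM : Function.Injective M)
    (hS : ∀ v, (0 ≤ v ∨ v ≤ 0) ↔ (0 ≤ M v ∨ M v ≤ 0))
    (hpos : ∀ v, 0 ≤ v → 0 ≤ ∑ j, M v j) (v : ι → ℝ) : 0 ≤ v ↔ 0 ≤ M v := by
  have key : ∀ v, 0 ≤ v → 0 ≤ M v := fun v hv =>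
    nonneg_of_signed_of_sum_nonneg ((hS v).1 (Or.inl hv)) (hpos v hv)
  refine ⟨key v, fun h => ?_⟩
  rcases (hS v).2 (Or.inl h) with hv | hv
  · exact hv
  · have h' := key (-v) (neg_nonneg.2 hv)
    rw [map_neg, neg_nonneg] at h'
    have h0 : M v = 0 := le_antisymm h' h
    rw [(map_eq_zero_iff M hM).1 h0]

theorem sum_map_nonneg_or_nonpos {M : (ι → ℝ) →ₗ[ℝ] (ι → ℝ)} (hM : Function.Injective M)
    (hS : ∀ v, (0 ≤ v ∨ v ≤ 0) ↔ (0 ≤ M v ∨ M v ≤ 0)) :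
    (∀ v, 0 ≤ v → 0 ≤ ∑ j, M v j) ∨ (∀ v, 0 ≤ v → ∑ j, M v j ≤ 0) := by
  by_contra! ⟨⟨w, hw, hw'⟩, v, hv, hv'⟩
  set a := ∑ j, M v j
  set b := ∑ j, M w j
  have hb : 0 ≤ -b := by linarith
  have hvb : 0 ≤ (-b) • v := smul_nonneg hb hv
  have hwa : 0 ≤ a • w := smul_nonneg hv'.le hw
  have hsum : ∑ j, M ((-b) • v + a • w) j = 0 := by
    simp only [map_add, map_smul, Pi.add_apply, Pi.smul_apply, smul_eq_mul,
      Finset.sum_add_distrib, ← Finset.mul_sum]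
    change -b * a + a * b = 0
    ring
  have h0 := eq_zero_of_signed_of_sum_eq_zero
    ((hS _).1 (Or.inl (add_nonneg hvb hwa))) hsum
  rw [map_eq_zero_iff M hM, add_eq_zero_iff_of_nonneg hvb hwa] at h0
  have hv0 : v = 0 := (smul_eq_zero.1 h0.1).resolve_left (by linarith)
  have ha : a = 0 := by simp [a, hv0]
  linarith

variable [DecidableEq ι]

/-- A bijective linear map preserving the nonnegative orthant in both directions is monomial. -/
theorem exists_perm_of_nonneg_iff {N : (ι → ℝ) →ₗ[ℝ] (ι → ℝ)} (hN : Function.Bijective N)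
    (h : ∀ v, 0 ≤ v ↔ 0 ≤ N v) :
    ∃ (d : ι → ℝ) (σ : Equiv.Perm ι), (∀ i, 0 < d i) ∧ ∀ v i, N v i = d i * v (σ i) := by
  have single_map : ∀ i, ∃ p, ∃ c : ℝ, 0 < c ∧ N (Pi.single i 1) = c • Pi.single p 1 := by
    intro i
    set x := N (Pi.single i 1) with hx
    have hx0 : 0 ≤ x := (h _).1 (Pi.single_nonneg.2 zero_le_one)
    have hxne : x ≠ 0 := fun h0 => by
      have := (map_eq_zero_iff N hN.1).1 h0
      simp at this
    obtain ⟨p, hp⟩ := Function.ne_iff.1 hxne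
    have hp0 : 0 < x p := lt_of_le_of_ne (hx0 p) (Ne.symm hp)
    obtain ⟨y, hy⟩ := hN.2 (Pi.single p (x p))
    have hy0 : 0 ≤ y := (h y).2 (hy ▸ Pi.single_nonneg.2 hp0.le)
    have hyle : y ≤ Pi.single i 1 := by
      rw [← sub_nonneg, h, map_sub, hy, ← hx, sub_nonneg]
      intro j
      rcases eq_or_ne j p with rfl | hj
      · simp
      · simpa [hj] using hx0 j
    have hyi : y = y i • Pi.single i 1 := by
      ext j
      rcases eq_or_ne j i with rfl | hj
      · simp
      · have h1 := hyle j
        have h2 := hy0 j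
        simp only [Pi.single_eq_of_ne hj, Pi.zero_apply] at h1 h2
        simp [hj, le_antisymm h1 h2]
    have hmap : y i • x = Pi.single p (x p) := by rw [hx, ← map_smul, ← hyi, hy]
    have hyi0 : 0 < y i := by
      refine lt_of_le_of_ne (hy0 i) fun h0 => ?_
      have := congrFun hmap p
      simp [← h0] at this
      exact hp this.symm
    refine ⟨p, (y i)⁻¹ * x p, by positivity, ?_⟩
    rw [mul_smul, eq_inv_smul_iff₀ hyi0.ne', hmap]
    ext j
    rcases eq_or_ne j p with rfl | hj <;> simp [*]
  choose τ c hc hτ using single_map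
  have hinj : Function.Injective τ := by
    intro i j hij
    by_contra hne
    have h1 : N (c j • Pi.single i 1) = N (c i • Pi.single j 1) := by
      rw [map_smul, map_smul, hτ, hτ, hij, smul_smul, smul_smul, mul_comm]
    have h2 := congrFun (hN.1 h1) i
    simp [hne] at h2
    exact (hc j).ne' h2
  let e : Equiv.Perm ι := Equiv.ofBijective τ (Finite.injective_iff_bijective.1 hinj)
  refine ⟨fun i => c (e.symm i), e.symm, fun i => hc _, fun v i => ?_⟩
  obtain ⟨k, rfl⟩ := e.surjective i
  have hv : v = ∑ j, v j • Pi.single j (1 : ℝ) := by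
    ext j
    simp [Finset.sum_apply, Pi.single_apply]
  conv_lhs => rw [hv]
  simp only [map_sum, map_smul, hτ, Finset.sum_apply, Pi.smul_apply, smul_eq_mul,
    Equiv.symm_apply_apply]
  rw [Finset.sum_eq_single k]
  · simp [e, mul_comm]
  · intro j _ hj
    have : e k ≠ τ j := fun h => hj (hinj h).symm
    simp [this]
  · simp

/-- A linear map carrying the union of the nonnegative and nonpositive orthants onto itself
is, up to sign, a positive monomial map. -/
theorem exists_perm_of_image_signed {M : (ι → ℝ) →ₗ[ℝ] (ι → ℝ)}
    (hM : M '' {v | 0 ≤ v ∨ v ≤ 0} = {v | 0 ≤ v ∨ v ≤ 0}) :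
    ∃ (d : ι → ℝ) (σ : Equiv.Perm ι), (∀ i, 0 < d i) ∧
      ((∀ v i, M v i = d i * v (σ i)) ∨ ∀ v i, M v i = -(d i * v (σ i))) := by
  have hsurj : Function.Surjective M := by
    intro v
    obtain ⟨a, -, ha⟩ := hM.ge (Or.inl (posPart_nonneg v))
    obtain ⟨b, -, hb⟩ := hM.ge (Or.inl (negPart_nonneg v))
    exact ⟨a - b, by rw [map_sub, ha, hb, posPart_sub_negPart]⟩
  have hinj : Function.Injective M := LinearMap.injective_iff_surjective.2 hsurj
  have hS : ∀ v, (0 ≤ v ∨ v ≤ 0) ↔ (0 ≤ M v ∨ M v ≤ 0) := by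
    intro v
    change v ∈ {v : ι → ℝ | 0 ≤ v ∨ v ≤ 0} ↔ M v ∈ {v : ι → ℝ | 0 ≤ v ∨ v ≤ 0}
    conv_rhs => rw [← hM]
    exact hinj.mem_set_image.symm
  rcases sum_map_nonneg_or_nonpos hinj hS with hpos | hneg
  · obtain ⟨d, σ, hd, hσ⟩ := exists_perm_of_nonneg_iff ⟨hinj, hsurj⟩
      (nonneg_iff_of_signed_iff hinj hS hpos)
    exact ⟨d, σ, hd, Or.inl hσ⟩
  · have hinj' : Function.Injective (-M) := neg_injective.comp hinj
    have hsurj' : Function.Surjective (-M) := neg_surjective.comp hsurj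
    obtain ⟨d, σ, hd, hσ⟩ := exists_perm_of_nonneg_iff ⟨hinj', hsurj'⟩
      (nonneg_iff_of_signed_iff hinj'
        (fun v => by simpa [or_comm] using hS v)
        (fun v hv => by simpa using hneg v hv))
    exact ⟨d, σ, hd, Or.inr fun v i => by rw [← hσ]; simp⟩

end SignCone

section TwoByTwo

theorem isSRk_one_iff (A : Matrix (Fin 2) (Fin 2) ℝ) :
    IsSRk 1 A ↔ (∀ i j, 0 ≤ A i j) ∨ ∀ i j, A i j ≤ 0 := by
  constructor
  · intro h
    obtain ⟨ε, hε, h⟩ := h 1 le_rfl le_rfl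
    have key : ∀ i j, A i j ≠ 0 → 0 < ε * A i j := fun i j hij => by
      simpa using h (fun _ => i) (fun _ => j) (Subsingleton.strictMono _)
        (Subsingleton.strictMono _) (by simpa using hij)
    rcases hε with rfl | rfl
    · refine Or.inl fun i j => ?_
      by_contra! hlt
      linarith [key i j hlt.ne]
    · refine Or.inr fun i j => ?_
      by_contra! hlt
      linarith [key i j hlt.ne']
  · intro h r hr hr'
    obtain rfl : r = 1 := le_antisymm hr' hr
    rcases h with h | h
    · refine ⟨1, Or.inl rfl, fun f g _ _ hne => ?_⟩
      simp only [det_unique, submatrix_apply] at hne ⊢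
      rw [one_mul]
      exact lt_of_le_of_ne (h _ _) hne.symm
    · refine ⟨-1, Or.inr rfl, fun f g _ _ hne => ?_⟩
      simp only [det_unique, submatrix_apply] at hne ⊢
      linarith [lt_of_le_of_ne (h _ _) hne]

theorem Fin.eq_id_of_strictMono {n : ℕ} {f : Fin n → Fin n} (hf : StrictMono f) : f = id :=
  hf.range_inj strictMono_id |>.1 <| by
    rw [Set.range_id, (Finite.injective_iff_surjective.1 hf.injective).range_eq]

/-- The only `2 × 2` minor of a `2 × 2` matrix puts no constraint on sign regularity. -/
theorem isSR_two_by_two_iff (A : Matrix (Fin 2) (Fin 2) ℝ) : IsSR A ↔ IsSRk 1 A := by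
  constructor
  · exact fun h r hr hr' => h r hr (hr'.trans (by simp))
  · intro h r hr hr'
    rw [min_self] at hr'
    obtain rfl | rfl : r = 1 ∨ r = 2 := by omega
    · exact h 1 le_rfl le_rfl
    · rcases le_total 0 A.det with hd | hd
      · refine ⟨1, Or.inl rfl, fun f g hf hg hne => ?_⟩
        rw [Fin.eq_id_of_strictMono hf, Fin.eq_id_of_strictMono hg, submatrix_id_id] at hne ⊢
        rw [one_mul]
        exact lt_of_le_of_ne hd hne.symm
      · refine ⟨-1, Or.inr rfl, fun f g hf hg hne => ?_⟩
        rw [Fin.eq_id_of_strictMono hf, Fin.eq_id_of_strictMono hg, submatrix_id_id] at hne ⊢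
        linarith [lt_of_le_of_ne hd hne]

/-- `T` is a composition of one or more elementary transformations. -/
def IsElem2Comp (T : Matrix (Fin 2) (Fin 2) ℝ → Matrix (Fin 2) (Fin 2) ℝ) : Prop :=
  ∃ L : List (Matrix (Fin 2) (Fin 2) ℝ → Matrix (Fin 2) (Fin 2) ℝ),
    L ≠ [] ∧ (∀ T ∈ L, Elem2Map T) ∧ T = L.foldr (· ∘ ·) id

theorem Elem2Map.isElem2Comp {T : Matrix (Fin 2) (Fin 2) ℝ → Matrix (Fin 2) (Fin 2) ℝ}
    (hT : Elem2Map T) : IsElem2Comp T :=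
  ⟨[T], by simp, by simpa using hT, rfl⟩

theorem List.foldr_comp_append {α : Type*} (L₁ L₂ : List (α → α)) :
    (L₁ ++ L₂).foldr (· ∘ ·) id = L₁.foldr (· ∘ ·) id ∘ L₂.foldr (· ∘ ·) id := by
  induction L₁ with
  | nil => rfl
  | cons f L ih => rw [List.cons_append, List.foldr_cons, ih]; rfl

theorem IsElem2Comp.comp {T U : Matrix (Fin 2) (Fin 2) ℝ → Matrix (Fin 2) (Fin 2) ℝ}
    (hT : IsElem2Comp T) (hU : IsElem2Comp U) : IsElem2Comp (T ∘ U) := by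
  obtain ⟨L₁, h₁, hL₁, rfl⟩ := hT
  obtain ⟨L₂, -, hL₂, rfl⟩ := hU
  refine ⟨L₁ ++ L₂, by simp [h₁], fun T hT => ?_, (List.foldr_comp_append _ _).symm⟩
  exact (List.mem_append.1 hT).elim (hL₁ T) (hL₂ T)

theorem exchangeMat_two_mul (A : Matrix (Fin 2) (Fin 2) ℝ) :
    exchangeMat 2 * A = !![A 1 0, A 1 1; A 0 0, A 0 1] := by
  ext i j
  fin_cases i <;> fin_cases j <;> simp [exchangeMat, mul_apply, Fin.rev]

theorem isSRk_one_of_forall_mem {A B : Matrix (Fin 2) (Fin 2) ℝ} (hA : IsSRk 1 A)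
    (h : ∀ i j, ∃ c k l, 0 ≤ c ∧ B i j = c * A k l) : IsSRk 1 B := by
  rw [isSRk_one_iff] at hA ⊢
  refine hA.imp (fun hA i j => ?_) fun hA i j => ?_ <;> obtain ⟨c, k, l, hc, hB⟩ := h i j
  · exact hB ▸ mul_nonneg hc (hA k l)
  · exact hB ▸ mul_nonpos_of_nonneg_of_nonpos hc (hA k l)

theorem isSRk_one_neg {A : Matrix (Fin 2) (Fin 2) ℝ} (hA : IsSRk 1 A) : IsSRk 1 (-A) := by
  rw [isSRk_one_iff] at hA ⊢
  simpa [or_comm] using hA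

theorem image_isSRk_one_eq {T U : Matrix (Fin 2) (Fin 2) ℝ → Matrix (Fin 2) (Fin 2) ℝ}
    (hT : ∀ A, IsSRk 1 A → IsSRk 1 (T A)) (hU : ∀ A, IsSRk 1 A → IsSRk 1 (U A))
    (hTU : ∀ A, T (U A) = A) : T '' {A | IsSRk 1 A} = {A | IsSRk 1 A} :=
  Set.Subset.antisymm (Set.image_subset_iff.2 hT) fun A hA => ⟨U A, hU A hA, hTU A⟩

theorem Elem2Map.image_isSRk_one {T : Matrix (Fin 2) (Fin 2) ℝ → Matrix (Fin 2) (Fin 2) ℝ}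
    (hT : Elem2Map T) : T '' {A | IsSRk 1 A} = {A | IsSRk 1 A} := by
  rcases hT with ⟨H, hH, rfl⟩ | rfl | rfl | rfl | rfl
  · refine image_isSRk_one_eq (U := fun A => of fun i j => (H i j)⁻¹ * A i j)
      (fun A hA => isSRk_one_of_forall_mem hA fun i j => ⟨H i j, i, j, (hH i j).le, rfl⟩)
      (fun A hA => isSRk_one_of_forall_mem hA fun i j =>
        ⟨(H i j)⁻¹, i, j, (inv_pos.2 (hH i j)).le, rfl⟩) fun A => ?_
    ext i j
    simp [(hH i j).ne']
  · exact image_isSRk_one_eq (fun A => isSRk_one_neg) (fun A => isSRk_one_neg) neg_neg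
  · have h : ∀ A : Matrix (Fin 2) (Fin 2) ℝ, IsSRk 1 A → IsSRk 1 (exchangeMat 2 * A) :=
      fun A hA => isSRk_one_of_forall_mem hA fun i j =>
        ⟨1, i.rev, j, zero_le_one, by
          rw [exchangeMat_two_mul]; fin_cases i <;> fin_cases j <;> simp [Fin.rev]⟩
    refine image_isSRk_one_eq h h fun A => ?_
    ext i j
    simp only [exchangeMat_two_mul]
    fin_cases i <;> fin_cases j <;> rfl
  · have h : ∀ A : Matrix (Fin 2) (Fin 2) ℝ, IsSRk 1 A → IsSRk 1 Aᵀ :=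
      fun A hA => isSRk_one_of_forall_mem hA fun i j =>
        ⟨1, j, i, zero_le_one, (one_mul _).symm⟩
    exact image_isSRk_one_eq h h transpose_transpose
  · have h : ∀ A : Matrix (Fin 2) (Fin 2) ℝ, IsSRk 1 A →
        IsSRk 1 !![A 0 0, A 0 1; A 1 1, A 1 0] :=
      fun A hA => isSRk_one_of_forall_mem hA fun i j =>
        ⟨1, i, if i = 0 then j else j.rev, zero_le_one, by
          fin_cases i <;> fin_cases j <;> simp [Fin.rev]⟩
    refine image_isSRk_one_eq h h fun A => ?_
    ext i j
    fin_cases i <;> fin_cases j <;> rfl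

theorem IsElem2Comp.image_isSRk_one {T : Matrix (Fin 2) (Fin 2) ℝ → Matrix (Fin 2) (Fin 2) ℝ}
    (hT : IsElem2Comp T) : T '' {A | IsSRk 1 A} = {A | IsSRk 1 A} := by
  obtain ⟨L, -, hL, rfl⟩ := hT
  induction L with
  | nil => exact Set.image_id _
  | cons T L ih =>
    rw [List.foldr_cons, Set.image_comp, ih fun U hU => hL U (List.mem_cons_of_mem _ hU),
      (hL T List.mem_cons_self).image_isSRk_one]

/-- Listing the entries of a `2 × 2` matrix row by row. -/
def entriesEquiv : Matrix (Fin 2) (Fin 2) ℝ ≃ₗ[ℝ] (Fin 4 → ℝ) where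
  toFun A := ![A 0 0, A 0 1, A 1 0, A 1 1]
  invFun v := !![v 0, v 1; v 2, v 3]
  map_add' A B := by ext i; fin_cases i <;> rfl
  map_smul' c A := by ext i; fin_cases i <;> rfl
  left_inv A := by ext i j; fin_cases i <;> fin_cases j <;> rfl
  right_inv v := by ext i; fin_cases i <;> rfl

/-- Permutation of the four entries of a `2 × 2` matrix. -/
def permEntries (σ : Equiv.Perm (Fin 4)) (A : Matrix (Fin 2) (Fin 2) ℝ) :
    Matrix (Fin 2) (Fin 2) ℝ :=
  entriesEquiv.symm (entriesEquiv A ∘ σ)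

theorem permEntries_mul (σ τ : Equiv.Perm (Fin 4)) :
    permEntries (σ * τ) = permEntries τ ∘ permEntries σ := by
  ext1 A
  simp [permEntries, Function.comp_assoc]

theorem isElem2Comp_permEntries (σ : Equiv.Perm (Fin 4)) : IsElem2Comp (permEntries σ) := by
  have hP : IsElem2Comp fun A => exchangeMat 2 * A :=
    Elem2Map.isElem2Comp (Or.inr (Or.inr (Or.inl rfl)))
  have hE : IsElem2Comp fun A => !![A 0 0, A 0 1; A 1 1, A 1 0] :=
    Elem2Map.isElem2Comp (Or.inr (Or.inr (Or.inr (Or.inr rfl))))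
  have hσ : σ ∈ Submonoid.closure
      (Set.range fun i : Fin 3 => Equiv.swap i.castSucc i.succ) := by
    rw [Equiv.Perm.mclosure_swap_castSucc_succ]
    trivial
  induction hσ using Submonoid.closure_induction with
  | mem σ hσ =>
    obtain ⟨i, rfl⟩ := hσ
    fin_cases i
    · convert (hP.comp hE).comp hP using 1
      ext A i j
      simp only [Function.comp, exchangeMat_two_mul]
      fin_cases i <;> fin_cases j <;> rfl
    · convert Elem2Map.isElem2Comp (Or.inr (Or.inr (Or.inr (Or.inl rfl)))) using 1
      ext A i j
      fin_cases i <;> fin_cases j <;> rfl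
    · convert hE using 1
      ext A i j
      fin_cases i <;> fin_cases j <;> rfl
  | one =>
    convert hP.comp hP using 1
    ext A i j
    simp only [Function.comp, exchangeMat_two_mul]
    fin_cases i <;> fin_cases j <;> rfl
  | mul σ τ _ _ h₁ h₂ =>
    rw [permEntries_mul]
    exact h₂.comp h₁

theorem image_entriesEquiv_isSRk_one :
    entriesEquiv '' {A | IsSRk 1 A} = {v | 0 ≤ v ∨ v ≤ 0} := by
  ext v
  rw [LinearEquiv.image_eq_preimage_symm, Set.mem_preimage, Set.mem_ofPred_eq, isSRk_one_iff]
  simp [Pi.le_def, Fin.forall_fin_succ, entriesEquiv, and_assoc]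

theorem isElem2Comp_of_image_isSRk_one
    {𝓛 : Matrix (Fin 2) (Fin 2) ℝ →ₗ[ℝ] Matrix (Fin 2) (Fin 2) ℝ}
    (h : 𝓛 '' {A | IsSRk 1 A} = {A | IsSRk 1 A}) : IsElem2Comp 𝓛 := by
  let M : (Fin 4 → ℝ) →ₗ[ℝ] (Fin 4 → ℝ) := entriesEquiv.conj 𝓛
  have hL : ∀ A, 𝓛 A = entriesEquiv.symm (M (entriesEquiv A)) := fun A => by
    simp [M, LinearEquiv.conj_apply]
  have hM : M '' {v | 0 ≤ v ∨ v ≤ 0} = {v | 0 ≤ v ∨ v ≤ 0} := by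
    rw [← image_entriesEquiv_isSRk_one]
    conv_rhs => rw [← h]
    simp only [Set.image_image]
    simp [M, LinearEquiv.conj_apply]
  obtain ⟨d, σ, hd, hσ⟩ := exists_perm_of_image_signed hM
  have hH : IsElem2Comp fun A => of fun i j => entriesEquiv.symm d i j * A i j :=
    Elem2Map.isElem2Comp <| Or.inl ⟨_, fun i j => by
      fin_cases i <;> fin_cases j <;> exact hd _, rfl⟩
  have hHσ := hH.comp (isElem2Comp_permEntries σ)
  rcases hσ with hσ | hσ
  · convert hHσ using 1
    ext A i j
    rw [hL, funext (hσ (entriesEquiv A))]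
    fin_cases i <;> fin_cases j <;> rfl
  · have hneg : IsElem2Comp fun A => -A := Elem2Map.isElem2Comp (Or.inr (Or.inl rfl))
    convert hneg.comp hHσ using 1
    ext A i j
    rw [hL, funext (hσ (entriesEquiv A))]
    fin_cases i <;> fin_cases j <;> rfl

end TwoByTwo


/-- a linear map `𝓛 : ℝ^{2×2} → ℝ^{2×2}` maps the SR matrices onto
themselves iff it maps the SR₁ matrices onto themselves, iff it is a
composition of one or more of the elementary transformations (a)–(e). -/
theorem sr_linear_preserver_two_by_two
    (𝓛 : Matrix (Fin 2) (Fin 2) ℝ →ₗ[ℝ] Matrix (Fin 2) (Fin 2) ℝ) :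
    ((⇑𝓛 '' {A | IsSR A} = {A | IsSR A}) ↔
      (⇑𝓛 '' {A | IsSRk 1 A} = {A | IsSRk 1 A})) ∧
    ((⇑𝓛 '' {A | IsSRk 1 A} = {A | IsSRk 1 A}) ↔
      (∃ L : List (Matrix (Fin 2) (Fin 2) ℝ → Matrix (Fin 2) (Fin 2) ℝ),
        L ≠ [] ∧ (∀ T ∈ L, Elem2Map T) ∧ ⇑𝓛 = L.foldr (· ∘ ·) id)) := by
  simp only [isSR_two_by_two_iff]
  exact ⟨trivial, isElem2Comp_of_image_isSRk_one, IsElem2Comp.image_isSRk_one⟩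
end
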